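/- arXiv:math/0304077 — 2 statements merged into one kernel-verified Lean document; each statement's English description precedes it below -/
import Mathlib

section
/- Let (θ_i, θ*_i, i=0..d; φ_j, φ'_j, j=1..d) be a parameter array. Then the sequence (θ_i, θ*_{d-i}, i=0..d; φ'_{d-j+1}, φ_{d-j+1}, j=1..d) is also a parameter array, and the sequence (θ_{d-i}, θ*_i, i=0..d; φ'_j, φ_j, j=1..d) is also a parameter array. -/
open Finset

/-- A parameter array of diameter `d` over `K`:
scalars `θ 0,…,θ d`, `θs 0,…,θs d`, `φ 1,…,φ d`, `φp 1,…,φp d`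
satisfying conditions (i)–(v) of the classification theorem. -/
def IsParameterArray (K : Type*) [Field K] (d : ℕ) (θ θs φ φp : ℕ → K) : Prop :=
  (∀ i, 1 ≤ i → i ≤ d → φ i ≠ 0 ∧ φp i ≠ 0) ∧
  (∀ i j, i ≤ d → j ≤ d → i ≠ j → θ i ≠ θ j ∧ θs i ≠ θs j) ∧
  (∀ i, 1 ≤ i → i ≤ d →
    φ i = φp 1 * (∑ h ∈ Finset.range i, (θ h - θ (d - h)) / (θ 0 - θ d))
      + (θs i - θs 0) * (θ (i - 1) - θ d)) ∧
  (∀ i, 1 ≤ i → i ≤ d →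
    φp i = φ 1 * (∑ h ∈ Finset.range i, (θ h - θ (d - h)) / (θ 0 - θ d))
      + (θs i - θs 0) * (θ (d - i + 1) - θ 0)) ∧
  (∃ β : K, ∀ i, 2 ≤ i → i + 1 ≤ d →
    (θ (i - 2) - θ (i + 1)) / (θ (i - 1) - θ i) = β ∧
    (θs (i - 2) - θs (i + 1)) / (θs (i - 1) - θs i) = β)

theorem pa_anti {K : Type*} [Field K] (n : ℕ) (b : K) (x y : ℕ → K)
    (hx : ∀ i, i + 2 ≤ n → x i - b * x (i+1) + x (i+2) = 0)
    (hy : ∀ i, i + 2 ≤ n → y i - b * y (i+1) + y (i+2) = 0)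
    (ax : ∀ i j, i + j = n → x i = - x j) (ay : ∀ i j, i + j = n → y i = - y j)
    (mx : ∀ m, m + m = n → x m = 0) (my : ∀ m, m + m = n → y m = 0) :
    ∀ i j, i ≤ n → j ≤ n → x i * y j = x j * y i := by
  have hW : ∀ i, i + 1 ≤ n → x i * y (i+1) - x (i+1) * y i = x 0 * y 1 - x 1 * y 0 := by
    intro i
    induction i with
    | zero => intro _; simp
    | succ k ih =>
      intro hk
      have h1 := hx k (by omega)
      have h2 := hy k (by omega)
      have h3 := ih (by omega)
      linear_combination h3 + x (k+1) * h2 - y (k+1) * h1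
  have hW0 : 1 ≤ n → x 0 * y 1 - x 1 * y 0 = 0 := by
    intro hn
    rcases Nat.even_or_odd' n with ⟨m, hm | hm⟩
    · obtain ⟨k, rfl⟩ : ∃ k, m = k + 1 := ⟨m - 1, by omega⟩
      have h1 := hW k (by omega)
      rw [mx (k+1) (by omega), my (k+1) (by omega)] at h1
      linear_combination -h1
    · have h1 := hW m (by omega)
      rw [ax m (m+1) (by omega), ay m (m+1) (by omega)] at h1
      linear_combination -h1
  have key : ∀ i k, i + k + 1 ≤ n → x i * y (i+k) = x (i+k) * y i ∧
      x i * y (i+k+1) = x (i+k+1) * y i := by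
    intro i k
    induction k with
    | zero =>
      intro hk
      refine ⟨by simp, ?_⟩
      have h1 := hW i (by omega)
      have h2 := hW0 (by omega)
      simp only [Nat.add_zero]
      linear_combination h1 + h2
    | succ k ih =>
      intro hk
      obtain ⟨h1, h2⟩ := ih (by omega)
      refine ⟨h2, ?_⟩
      have h3 := hx (i+k) (by omega)
      have h4 := hy (i+k) (by omega)
      have e1 : i + (k+1) + 1 = i + k + 2 := by omega
      rw [e1]
      linear_combination b * h2 - h1 + x i * h4 - y i * h3
  have key2 : ∀ i j, i ≤ j → j ≤ n → x i * y j = x j * y i := by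
    intro i j hij hj
    rcases Nat.eq_or_lt_of_le hij with h | h
    · subst h; ring
    · obtain ⟨k, rfl⟩ : ∃ k, j = i + k + 1 := ⟨j - i - 1, by omega⟩
      exact (key i k hj).2
  intro i j hi hj
  rcases Nat.le_total i j with h | h
  · exact key2 i j h hj
  · exact (key2 j i h hi).symm

theorem pa_sym {K : Type*} [Field K] (d : ℕ) (b g g' : K) (v w : ℕ → K)
    (hv : ∀ i, i + 2 ≤ d → v i - b * v (i+1) + v (i+2) = g)
    (hw : ∀ i, i + 2 ≤ d → w i - b * w (i+1) + w (i+2) = g')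
    (sv : ∀ i j, i + j = d → v i = v j) (sw : ∀ i j, i + j = d → w i = w j)
    (v0 : v 0 = 0) (w0 : w 0 = 0) :
    ∀ i j, i ≤ d → j ≤ d → v i * w j = v j * w i := by
  rcases d with _ | n
  · intro i j hi hj
    obtain rfl : i = 0 := by omega
    obtain rfl : j = 0 := by omega
    ring
  have A := pa_anti n b (fun i => v (i+1) - v i) (fun i => w (i+1) - w i)
    (by intro i hi
        have h1 := hv i (by omega)
        have h2 := hv (i+1) (by omega)
        linear_combination h2 - h1)
    (by intro i hi
        have h1 := hw i (by omega)
        have h2 := hw (i+1) (by omega)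
        linear_combination h2 - h1)
    (by intro i j hij
        have h1 := sv i (j+1) (by omega)
        have h2 := sv (i+1) j (by omega)
        linear_combination h2 - h1)
    (by intro i j hij
        have h1 := sw i (j+1) (by omega)
        have h2 := sw (i+1) j (by omega)
        linear_combination h2 - h1)
    (by intro m hm
        have h1 := sv m (m+1) (by omega)
        linear_combination - h1)
    (by intro m hm
        have h1 := sw m (m+1) (by omega)
        linear_combination - h1)
  have B : ∀ i j, i ≤ n + 1 → j ≤ n → v i * (w (j+1) - w j) = (v (j+1) - v j) * w i := by
    intro i j hi hj
    induction i with
    | zero => rw [v0, w0]; ring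
    | succ i ih =>
      have h1 := ih (by omega)
      have h2 := A i j (by omega) hj
      try simp only at h2
      linear_combination h1 + h2
  intro i j hi hj
  induction j with
  | zero => rw [v0, w0]; ring
  | succ j ih =>
    have h1 := ih (by omega)
    have h2 := B i j hi (by omega)
    linear_combination h1 + h2

/-- The auxiliary bilinear expression. -/
def paT {K : Type*} [Field K] (d : ℕ) (θ t : ℕ → K) : ℕ → K
  | 0 => 0
  | i+1 => (t i - t d) * (θ (i+1) - θ 0) - (t (i+1) - t 0) * (θ i - θ d)

theorem pa_main {K : Type*} [Field K] (d : ℕ) (hd : 1 ≤ d) (b g g' : K) (θ t : ℕ → K)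
    (hθ : ∀ i, i + 2 ≤ d → θ i - b * θ (i+1) + θ (i+2) = g)
    (ht : ∀ i, i + 2 ≤ d → t i - b * t (i+1) + t (i+2) = g')
    (h0 : θ 0 - θ d ≠ 0) :
    (∀ i, i ≤ d → paT d θ t i * (θ 0 - θ d) =
      paT d θ t d * ∑ h ∈ Finset.range i, (θ h - θ (d - h))) := by
  have anti : ∀ f : ℕ → K, ∀ i j, i + j = d → f i - f (d - i) = -(f j - f (d - j)) := by
    intro f i j hij
    obtain rfl : i = d - j := by omega
    rw [show d - (d - j) = j by omega]; ring
  have mid : ∀ f : ℕ → K, ∀ m, m + m = d → f m - f (d - m) = 0 := by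
    intro f m hm
    rw [show d - m = m by omega]; ring
  have rec_a : ∀ (f : ℕ → K) (c : K), (∀ i, i + 2 ≤ d → f i - b * f (i+1) + f (i+2) = c) →
      ∀ i, i + 2 ≤ d → (f i - f (d - i)) - b * (f (i+1) - f (d - (i+1))) +
        (f (i+2) - f (d - (i+2))) = 0 := by
    intro f c hf i hi
    obtain ⟨j, rfl⟩ : ∃ j, d = i + 2 + j := ⟨d - (i+2), by omega⟩
    rw [show i + 2 + j - i = j + 2 by omega, show i + 2 + j - (i+1) = j + 1 by omega,
      show i + 2 + j - (i+2) = j by omega]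
    have h1 := hf i (by omega)
    have h2 := hf j (by omega)
    linear_combination h1 - h2
  have P := pa_anti d b (fun i => θ i - θ (d - i)) (fun i => t i - t (d - i))
    (rec_a θ g hθ) (rec_a t g' ht) (anti θ) (anti t) (mid θ) (mid t)
  have P0 : ∀ i j, i + j = d → (θ 0 - θ d) * (t i - t j) = (θ i - θ j) * (t 0 - t d) := by
    intro i j hij
    obtain rfl : j = d - i := by omega
    have := P 0 i (by omega) (by omega)
    simpa using this
  have Q := pa_sym d b ((θ 0 - θ d) * (g' - (2 - b) * t 0) - (t 0 - t d) * (g - (2 - b) * θ 0))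
    (2 * g - (2 - b) * (θ 0 + θ d))
    (fun i => (θ 0 - θ d) * (t i - t 0) - (t 0 - t d) * (θ i - θ 0))
    (fun i => θ i + θ (d - i) - (θ 0 + θ d))
    (by intro i hi
        have h1 := hθ i hi
        have h2 := ht i hi
        linear_combination (θ 0 - θ d) * h2 - (t 0 - t d) * h1)
    (by intro i hi
        obtain ⟨j, hj⟩ : ∃ j, d = i + 2 + j := ⟨d - (i+2), by omega⟩
        try simp only
        rw [show d - i = j + 2 by omega, show d - (i+1) = j + 1 by omega,
          show d - (i+2) = j by omega]
        have h1 := hθ i (by omega)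
        have h2 := hθ j (by omega)
        linear_combination h1 + h2)
    (by intro i j hij
        have := P0 i j hij
        linear_combination this)
    (by intro i j hij
        try simp only
        rw [show d - i = j by omega, show d - j = i by omega]; ring)
    (by simp) (by simp)
  have Tsym0 : ∀ i j, i + j + 1 = d → paT d θ t (i+1) = paT d θ t (j+1) := by
    intro i j hij
    apply mul_left_cancel₀ h0
    have q := Q i (i+1) (by omega) (by omega)
    try simp only at q
    rw [show d - i = j + 1 by omega, show d - (i+1) = j by omega] at q
    have p1 := P0 i (j+1) (by omega)
    have p2 := P0 (i+1) j (by omega)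
    simp only [paT]
    linear_combination q - (θ j - θ d) * p1 + (θ (j+1) - θ 0) * p2
  have Tend : paT d θ t (d+1) = 0 := by simp [paT]
  have Tsym : ∀ i j, i + j = d + 1 → paT d θ t i = paT d θ t j := by
    intro i j hij
    rcases i with _ | i
    · obtain rfl : j = d + 1 := by omega
      rw [Tend]; rfl
    rcases j with _ | j
    · obtain rfl : i = d := by omega
      rw [Tend]; rfl
    exact Tsym0 i j (by omega)
  have Drec : ∀ i, i + 2 ≤ d → (paT d θ t (i+1) - paT d θ t i) -
      b * (paT d θ t (i+1+1) - paT d θ t (i+1)) +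
      (paT d θ t (i+2+1) - paT d θ t (i+2)) = 0 := by
    intro c hc
    have q1 := hθ c hc
    have r1 := ht c hc
    have e2 : (t (c+2) - t d) * (θ (c+1) - b * θ (c+2) + θ (c+3) - g) = 0 := by
      rcases Nat.eq_or_lt_of_le hc with h | h
      · rw [h]; ring
      · rw [hθ (c+1) (by omega)]; ring
    have e3 : (θ (c+2) - θ d) * (t (c+1) - b * t (c+2) + t (c+3) - g') = 0 := by
      rcases Nat.eq_or_lt_of_le hc with h | h
      · rw [h]; ring
      · rw [ht (c+1) (by omega)]; ring
    rcases c with _ | k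
    · simp only [paT, Nat.zero_add] at *
      linear_combination e2 - e3 + (-b * t 1 - g' + t d + t 0) * q1
        - (-b * θ 1 - g + θ d + θ 0) * r1
    · have q0 := hθ k (by omega)
      have r0 := ht k (by omega)
      simp only [paT] at *
      linear_combination e2 - e3 + (-b * t (k+1+1) - g' + t d + t 0) * q1
        - (-b * θ (k+1+1) - g + θ d + θ 0) * r1
        + (t (k+1) - t 0) * q0 - (θ (k+1) - θ 0) * r0
  have R := pa_anti d b (fun i => paT d θ t (i+1) - paT d θ t i) (fun i => θ i - θ (d - i))
    Drec (rec_a θ g hθ)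
    (by intro i j hij
        have h1 := Tsym (i+1) j (by omega)
        have h2 := Tsym i (j+1) (by omega)
        linear_combination h1 - h2)
    (anti θ)
    (by intro m hm
        have h1 := Tsym (m+1) m (by omega)
        linear_combination h1)
    (mid θ)
  have T1 := Tsym 1 d (by omega)
  intro i hi
  induction i with
  | zero => simp [paT]
  | succ i ih =>
    have h1 := ih (by omega)
    have h2 := R i 0 (by omega) (by omega)
    simp only [Nat.sub_zero, Nat.zero_add] at h2
    rw [T1] at h2
    have T0 : paT d θ t 0 = 0 := rfl
    rw [T0] at h2
    rw [Finset.sum_range_succ]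
    linear_combination h1 + h2

theorem pa_sigma {K : Type*} [Field K] (d : ℕ) (θ : ℕ → K) :
    ∀ i j, i + j = d + 1 → ∑ h ∈ Finset.range i, (θ h - θ (d - h)) =
      ∑ h ∈ Finset.range j, (θ h - θ (d - h)) := by
  intro i
  induction i with
  | zero =>
    intro j hj
    obtain rfl : j = d + 1 := by omega
    have e := Finset.sum_range_reflect θ (d+1)
    simp only [Nat.add_sub_cancel] at e
    simp [Finset.sum_sub_distrib, e]
  | succ i ih =>
    intro j hj
    have h1 := ih (j+1) (by omega)
    rw [Finset.sum_range_succ] at h1 ⊢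
    rw [show d - j = i by omega] at h1
    rw [show d - i = j by omega]
    linear_combination h1

theorem pa_gamma {K : Type*} [Field K] (d : ℕ) (β : K) (θ : ℕ → K)
    (hne : ∀ i j, i ≤ d → j ≤ d → i ≠ j → θ i ≠ θ j)
    (h : ∀ i, 2 ≤ i → i + 1 ≤ d → (θ (i - 2) - θ (i + 1)) / (θ (i - 1) - θ i) = β) :
    ∃ g, ∀ i, i + 2 ≤ d → θ i - (β - 1) * θ (i+1) + θ (i+2) = g := by
  refine ⟨θ 0 - (β - 1) * θ 1 + θ 2, ?_⟩
  intro i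
  induction i with
  | zero => intro _; simp
  | succ k ih =>
    intro hk
    have h1 := ih (by omega)
    have h2 := h (k+2) (by omega) (by omega)
    rw [div_eq_iff (sub_ne_zero.2 (hne _ _ (by omega) (by omega) (by omega)))] at h2
    simp only [Nat.add_sub_cancel, show k + 2 - 1 = k + 1 by omega] at h2
    have e : k + 1 + 2 = k + 2 + 1 := by omega
    have e' : k + 1 + 1 = k + 2 := by omega
    rw [e, e']
    linear_combination h1 - h2

theorem pa_half {K : Type*} [Field K] (d : ℕ)
    (θ θs φ φp : ℕ → K) (h : IsParameterArray K d θ θs φ φp) :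
    ∀ i, 1 ≤ i → i ≤ d →
    φp (d - i + 1) = φ d * (∑ h ∈ Finset.range i, (θ h - θ (d - h)) / (θ 0 - θ d))
      + (θs (d - i) - θs d) * (θ (i - 1) - θ d) := by
  obtain ⟨_, h2, h3, h4, β, h5⟩ := h
  intro i hi hid
  have h0 : θ 0 - θ d ≠ 0 :=
    sub_ne_zero.2 (h2 0 d (by omega) (by omega) (by omega)).1
  obtain ⟨g, hg⟩ := pa_gamma d β θ (fun i j a b c => (h2 i j a b c).1)
    (fun i a b => (h5 i a b).1)
  obtain ⟨g', hg'⟩ := pa_gamma d β θs (fun i j a b c => (h2 i j a b c).2)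
    (fun i a b => (h5 i a b).2)
  have M := pa_main d (by omega) (β - 1) g g' θ (fun i => θs (d - i)) hg
    (by intro i hi
        obtain ⟨j, hj⟩ : ∃ j, d = i + 2 + j := ⟨d - (i+2), by omega⟩
        try simp only
        rw [show d - i = j + 2 by omega, show d - (i+1) = j + 1 by omega,
          show d - (i+2) = j by omega]
        have := hg' j (by omega)
        linear_combination this) h0 i hid
  have a1 := h4 (d - i + 1) (by omega) (by omega)
  have a2 := h3 d (by omega) le_rfl
  have a3 := h3 1 le_rfl (by omega)
  have s1 := pa_sigma d θ (d - i + 1) i (by omega)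
  have s2 := pa_sigma d θ d 1 (by omega)
  simp only [← Finset.sum_div] at a1 a2 a3 ⊢
  rw [s1] at a1
  rw [s2] at a2
  simp only [Finset.sum_range_one, Nat.sub_zero, Nat.sub_self, div_self h0] at a2 a3
  obtain ⟨k, rfl⟩ : ∃ k, i = k + 1 := ⟨i - 1, by omega⟩
  obtain ⟨e, rfl⟩ : ∃ e, d = e + 1 := ⟨d - 1, by omega⟩
  simp only [paT] at M
  simp only [Nat.add_sub_cancel, Nat.sub_self, Nat.sub_zero, show e + 1 - e = 1 by omega,
    show e + 1 - (k+1) + 1 = e + 1 - k by omega,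
    show e + 1 - (e + 1 - k) + 1 = k + 1 by omega] at *
  set σ := ∑ h ∈ Finset.range (k+1), (θ h - θ (e + 1 - h)) with hσ
  have hσ' : σ = (σ / (θ 0 - θ (e+1))) * (θ 0 - θ (e+1)) := by field_simp
  set S := σ / (θ 0 - θ (e+1)) with hS
  rw [hσ'] at M
  have M' := mul_right_cancel₀ h0 (M.trans (mul_assoc _ _ _).symm)
  rw [a1, a2, a3]
  linear_combination M'

theorem pa_rev {K : Type*} [Field K] (d : ℕ)
    (θ θs φ φp : ℕ → K) (h : IsParameterArray K d θ θs φ φp) :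
    IsParameterArray K d (fun i => θ (d - i)) θs φp φ := by
  obtain ⟨h1, h2, h3, h4, β, h5⟩ := h
  have hs : ∀ i, i ≤ d → ∑ h ∈ Finset.range i, (θ (d - h) - θ (d - (d - h))) / (θ (d - 0) - θ (d - d))
      = ∑ h ∈ Finset.range i, (θ h - θ (d - h)) / (θ 0 - θ d) := by
    intro i hi
    apply Finset.sum_congr rfl
    intro x hx
    have := Finset.mem_range.1 hx
    rw [show d - (d - x) = x by omega, Nat.sub_zero, Nat.sub_self,
      ← neg_sub (θ x), ← neg_sub (θ 0), neg_div_neg_eq]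
  refine ⟨fun i a b => (h1 i a b).symm, ?_, ?_, ?_, β, ?_⟩
  · intro i j hi hj hij
    exact ⟨(h2 (d - i) (d - j) (by omega) (by omega) (by omega)).1, (h2 i j hi hj hij).2⟩
  · intro i hi hid
    try simp only
    rw [hs i hid, h4 i hi hid, show d - (i - 1) = d - i + 1 by omega, Nat.sub_self]
  · intro i hi hid
    try simp only
    rw [hs i hid, h3 i hi hid, show d - (d - i + 1) = i - 1 by omega, Nat.sub_zero]
  · intro i hi hid
    refine ⟨?_, (h5 i hi hid).2⟩
    have := (h5 (d - i + 1) (by omega) (by omega)).1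
    try simp only
    rw [show d - (i - 2) = d - i + 1 + 1 by omega, show d - (i+1) = d - i + 1 - 2 by omega,
      show d - (i - 1) = d - i + 1 by omega, ← this, ← neg_sub (θ (d - i + 1 - 2)),
      ← neg_sub (θ (d - i)), neg_div_neg_eq, show d - i + 1 - 1 = d - i by omega]

theorem parameter_array_inversions {K : Type*} [Field K] (d : ℕ)
    (θ θs φ φp : ℕ → K) (h : IsParameterArray K d θ θs φ φp) :
    IsParameterArray K d θ (fun i => θs (d - i))
      (fun j => φp (d - j + 1)) (fun j => φ (d - j + 1)) ∧
    IsParameterArray K d (fun i => θ (d - i)) θs φp φ := by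
  have hr := pa_rev d θ θs φ φp h
  refine ⟨?_, hr⟩
  have A := pa_half d θ θs φ φp h
  have B := pa_half d _ θs φp φ hr
  obtain ⟨h1, h2, h3, h4, β, h5⟩ := h
  refine ⟨?_, ?_, ?_, ?_, β, ?_⟩
  · intro i hi hid
    exact (h1 (d - i + 1) (by omega) (by omega)).symm
  · intro i j hi hj hij
    exact ⟨(h2 i j hi hj hij).1, (h2 (d - i) (d - j) (by omega) (by omega) (by omega)).2⟩
  · intro i hi hid
    try simp only
    rw [A i hi hid, show d - 1 + 1 = d by omega, Nat.sub_zero]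
  · intro i hi hid
    have := B i hi hid
    try simp only at this ⊢
    rw [this, show d - 1 + 1 = d by omega, Nat.sub_zero, Nat.sub_self,
      show d - (i - 1) = d - i + 1 by omega]
    congr 2
    apply Finset.sum_congr rfl
    intro x hx
    have := Finset.mem_range.1 hx
    rw [show d - (d - x) = x by omega, ← neg_sub (θ x), ← neg_sub (θ 0), neg_div_neg_eq]
  · intro i hi hid
    refine ⟨(h5 i hi hid).1, ?_⟩
    have := (h5 (d - i + 1) (by omega) (by omega)).2
    try simp only
    rw [show d - (i - 2) = d - i + 1 + 1 by omega, show d - (i+1) = d - i + 1 - 2 by omega,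
      show d - (i - 1) = d - i + 1 by omega, ← this, ← neg_sub (θs (d - i + 1 - 2)),
      ← neg_sub (θs (d - i)), neg_div_neg_eq, show d - i + 1 - 1 = d - i by omega]
end

section
/- Let A, A* be a Leonard pair in Mat_{d+1}(K) with A lower bidiagonal, A* upper bidiagonal, and A_{i,i-1} = 1 for 1 ≤ i ≤ d (LB-UB canonical form). Then there exists a parameter array (θ_i, θ*_i; φ_j, φ'_j) over K with A_{ii} = θ_i, A*_{ii} = θ*_i for 0 ≤ i ≤ d and A*_{i-1,i} = φ_i for 1 ≤ i ≤ d; conversely, if such a parameter array exists with A_{i,i-1}=1, A lower bidiagonal, A* upper bidiagonal, then A, A* is a Leonard pair in Mat_{d+1}(K). -/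
open Polynomial Matrix Finset

variable {K : Type*} [Field K]

/-- The primitive idempotent of `A` associated with eigenvalue `θ i`:
`E i = ∏_{j ≠ i} (A - θ j • 1) / (θ i - θ j)`. -/
noncomputable def primIdem {d : ℕ} (A : Matrix (Fin (d + 1)) (Fin (d + 1)) K)
    (θ : Fin (d + 1) → K) (i : Fin (d + 1)) : Matrix (Fin (d + 1)) (Fin (d + 1)) K :=
  Polynomial.aeval A
    (∏ j ∈ Finset.univ.erase i,
      (Polynomial.C (θ i - θ j)⁻¹ * (Polynomial.X - Polynomial.C (θ j))))

/-- `A` is multiplicity-free with (distinct) eigenvalues `θ 0, …, θ d`. -/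
def MultFreeWith {d : ℕ} (A : Matrix (Fin (d + 1)) (Fin (d + 1)) K)
    (θ : Fin (d + 1) → K) : Prop :=
  Function.Injective θ ∧ A.charpoly = ∏ i, (Polynomial.X - Polynomial.C (θ i))

/-- `θ` is an eigenvalue sequence for the (ordered) pair `A, B`: the corresponding
ordering of the primitive idempotents of `A` is an idempotent sequence for `A, B`. -/
def IsEigenvalueSeq {d : ℕ} (A B : Matrix (Fin (d + 1)) (Fin (d + 1)) K)
    (θ : Fin (d + 1) → K) : Prop :=
  MultFreeWith A θ ∧
    ∀ i j : Fin (d + 1),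
      (1 < |((i : ℕ) : ℤ) - ((j : ℕ) : ℤ)| → primIdem A θ i * B * primIdem A θ j = 0) ∧
      (|((i : ℕ) : ℤ) - ((j : ℕ) : ℤ)| = 1 → primIdem A θ i * B * primIdem A θ j ≠ 0)

/-- `A, B` is a Leonard pair in `Mat_{d+1}(K)`. -/
def IsLeonardPair {d : ℕ} (A B : Matrix (Fin (d + 1)) (Fin (d + 1)) K) : Prop :=
  (∃ θ, IsEigenvalueSeq A B θ) ∧ (∃ θs, IsEigenvalueSeq B A θs)

/-- Every nonzero entry lies on the diagonal or the subdiagonal. -/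
def LowerBidiagonal {K : Type*} [Field K] {d : ℕ}
    (A : Matrix (Fin (d + 1)) (Fin (d + 1)) K) : Prop :=
  ∀ i j : Fin (d + 1), (i : ℕ) ≠ (j : ℕ) → (i : ℕ) ≠ (j : ℕ) + 1 → A i j = 0

/-- Every nonzero entry lies on the diagonal or the superdiagonal. -/
def UpperBidiagonal {K : Type*} [Field K] {d : ℕ}
    (A : Matrix (Fin (d + 1)) (Fin (d + 1)) K) : Prop :=
  ∀ i j : Fin (d + 1), (i : ℕ) ≠ (j : ℕ) → (j : ℕ) ≠ (i : ℕ) + 1 → A i j = 0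

/-- Every nonzero entry lies on the diagonal, subdiagonal, or superdiagonal. -/
def Tridiagonal {K : Type*} [Field K] {d : ℕ}
    (A : Matrix (Fin (d + 1)) (Fin (d + 1)) K) : Prop :=
  ∀ i j : Fin (d + 1), 1 < |((i : ℕ) : ℤ) - ((j : ℕ) : ℤ)| → A i j = 0

namespace LP

/-- second order affine recurrence on `0..m` -/
def Rec (β γ : K) (m : ℕ) (F : ℕ → K) : Prop :=
  ∀ j, j + 2 ≤ m → F (j + 2) - β * F (j + 1) + F j = γ

theorem wron (β : K) : ∀ (m : ℕ) (γ γ' : K) (F G : ℕ → K), 1 ≤ m → Rec β γ m F → Rec β γ' m G →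
    (F 0 - F m) * (G 1 - G (m - 1)) = (F 1 - F (m - 1)) * (G 0 - G m) := by
  intro m
  induction m using Nat.strong_induction_on with
  | _ m ih =>
    intro γ γ' F G hm hF hG
    obtain rfl | rfl | h3 : m = 1 ∨ m = 2 ∨ 3 ≤ m := by omega
    · simp; ring
    · simp
    · obtain ⟨n, rfl⟩ : ∃ n, m = n + 3 := ⟨m - 3, by omega⟩
      have h := ih (n + 1) (by omega) γ γ' (fun j => F (j + 1)) (fun j => G (j + 1)) (by omega)
        (fun j hj => hF (j + 1) (by omega)) (fun j hj => hG (j + 1) (by omega))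
      have f1 := hF 0 (by omega)
      have f2 := hF (n + 1) (by omega)
      have g1 := hG 0 (by omega)
      have g2 := hG (n + 1) (by omega)
      simp only [show n + 3 - 1 = n + 2 by omega, show n + 1 - 1 = n by omega,
        show n + 1 + 2 = n + 3 by omega, show n + 1 + 1 = n + 2 by omega, zero_add] at *
      linear_combination h + (f1 - f2) * (G 1 - G (n + 2)) - (F 1 - F (n + 2)) * (g1 - g2)

/-- antisymmetrised sequence partial sums -/
def S (d : ℕ) (θ : ℕ → K) (i : ℕ) : K := ∑ h ∈ Finset.range i, (θ h - θ (d - h))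

theorem S_succ (d : ℕ) (θ : ℕ → K) (i : ℕ) : S d θ (i + 1) = S d θ i + (θ i - θ (d - i)) :=
  Finset.sum_range_succ _ _

@[simp] theorem S_zero (d : ℕ) (θ : ℕ → K) : S d θ 0 = 0 := by simp [S]

theorem S_one (d : ℕ) (θ : ℕ → K) : S d θ 1 = θ 0 - θ d := by simp [S]

theorem S_eq (d : ℕ) (θ : ℕ → K) (i : ℕ) (hi : i ≤ d + 1) :
    S d θ i = ∑ h ∈ Finset.range i, θ h - ∑ h ∈ Finset.range i, θ (d + 1 - i + h) := by
  unfold S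
  rw [Finset.sum_sub_distrib]
  congr 1
  rw [← Finset.sum_range_reflect]
  apply Finset.sum_congr rfl
  intro h hh
  rw [Finset.mem_range] at hh
  congr 1; omega

theorem S_symm (d : ℕ) (θ : ℕ → K) (i : ℕ) (hi : i ≤ d + 1) :
    S d θ i = S d θ (d + 1 - i) := by
  rw [S_eq d θ i hi, S_eq d θ (d + 1 - i) (by omega)]
  have h1 := Finset.sum_range_add θ i (d + 1 - i)
  have h2 := Finset.sum_range_add θ (d + 1 - i) i
  rw [show i + (d + 1 - i) = d + 1 by omega] at h1
  rw [show (d + 1 - i) + i = d + 1 by omega] at h2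
  rw [show d + 1 - (d + 1 - i) = i by omega]
  linear_combination h2 - h1

theorem S_top (d : ℕ) (θ : ℕ → K) : S d θ (d + 1) = 0 := by
  rw [S_symm d θ (d + 1) le_rfl]; simp

theorem S_ident {β γ : K} {d : ℕ} {θ : ℕ → K} (hθ : Rec β γ d θ) (i : ℕ) (hi : 1 ≤ i)
    (hid : i + 1 ≤ d) :
    (S d θ (i + 1) - S d θ 1) * (θ 0 - θ (d - i + 1)) = (θ 1 - θ (d - i)) * S d θ i := by
  have h := wron β (d - i + 1) (∑ h ∈ Finset.range i, γ) γ
    (fun j => ∑ h ∈ Finset.range i, θ (j + h)) θ (by omega) ?_ ?_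
  · have e1 : S d θ i = ∑ h ∈ Finset.range i, θ (0 + h) -
        ∑ h ∈ Finset.range i, θ (d - i + 1 + h) := by
      rw [S_eq d θ i (by omega), show d + 1 - i = d - i + 1 by omega]; simp
    have e2 : S d θ (i + 1) - S d θ 1 = ∑ h ∈ Finset.range i, θ (1 + h) -
        ∑ h ∈ Finset.range i, θ (d - i + h) := by
      rw [S_eq d θ (i + 1) (by omega), show d + 1 - (i + 1) = d - i by omega, S_one,
        Finset.sum_range_succ', Finset.sum_range_succ (fun h => θ (d - i + h)),
        show d - i + i = d by omega]
      simp only [add_comm 1]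
      ring
    rw [e1, e2]
    simp only [Nat.add_sub_cancel] at h
    linear_combination -h
  · intro j hj
    simp only
    rw [← Finset.sum_congr rfl (fun h hh => hθ (j + h) (by
      rw [Finset.mem_range] at hh; omega))]
    rw [Finset.sum_add_distrib, Finset.sum_sub_distrib, Finset.mul_sum]
    simp only [add_right_comm]
  · intro j hj; exact hθ j (by omega)

/-- `η_i (x)` -/
def eta (d : ℕ) (θ : ℕ → K) (i : ℕ) (x : K) : K := ∏ h ∈ Finset.range i, (x - θ (d - h))

theorem eta_succ (d : ℕ) (θ : ℕ → K) (i : ℕ) (x : K) :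
    eta d θ (i + 1) x = eta d θ i x * (x - θ (d - i)) := Finset.prod_range_succ _ _

theorem eta_ident {β γ : K} {d : ℕ} {θ : ℕ → K} (hθ : Rec β γ d θ) (i : ℕ)
    (hid : i + 1 ≤ d) :
    (eta d θ (i + 1) (θ 0) - eta d θ (i + 1) (θ 1)) * (θ 0 - θ d)
      = (θ 0 - θ 1) * S d θ (i + 1) * eta d θ i (θ 0) := by
  induction i with
  | zero => simp [eta, S]
  | succ i ih =>
    have h1 := ih (by omega)
    have h2 := S_ident hθ (i + 1) (by omega) hid
    rw [S_one] at h2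
    have e := eta_succ d θ i (θ 0)
    rw [show d - (i + 1) + 1 = d - i by omega] at h2
    rw [eta_succ d θ (i + 1) (θ 0), eta_succ d θ (i + 1) (θ 1)]
    rw [e] at h1 ⊢
    linear_combination (θ 1 - θ (d - (i + 1))) * h1 - (θ 0 - θ 1) * eta d θ i (θ 0) * h2

/-- The omega expression. -/
def Om (β γ γs : K) (θ θs φ : ℕ → K) (i : ℕ) : K :=
  φ i - β * φ (i + 1) + φ (i + 2) + (θ i + θ (i + 1)) * (θs i + θs (i + 1))
    - β * (θ i * θs i + θ (i + 1) * θs (i + 1)) - γ * (θs i + θs (i + 1))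
    - γs * (θ i + θ (i + 1))

/-- the explicit form of φ -/
def psi (d : ℕ) (κ : K) (θ θs : ℕ → K) (i : ℕ) : K :=
  if i = 0 ∨ d < i then 0 else κ * S d θ i + (θs i - θs 0) * (θ (i - 1) - θ d)

theorem S_rec {β γ : K} {d : ℕ} {θ : ℕ → K} (hθ : Rec β γ d θ) (i : ℕ) (hi : i + 2 ≤ d) :
    S d θ (i + 3) - β * S d θ (i + 2) + S d θ (i + 1)
      = S d θ (i + 2) - β * S d θ (i + 1) + S d θ i := by
  have h1 := hθ i hi
  have h2 := hθ (d - (i + 2)) (by omega)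
  rw [show d - (i + 2) + 2 = d - i by omega, show d - (i + 2) + 1 = d - (i + 1) by omega] at h2
  rw [S_succ d θ (i + 2), S_succ d θ (i + 1), S_succ d θ i]
  linear_combination h1 - h2

theorem psi_Om {β γ γs κ : K} {d : ℕ} {θ θs : ℕ → K} (hθ : Rec β γ d θ) (hs : Rec β γs d θs)
    (i : ℕ) (hi : i + 2 ≤ d) :
    Om β γ γs θ θs (psi d κ θ θs) (i + 1) = Om β γ γs θ θs (psi d κ θ θs) i := by
  have p0 : psi d κ θ θs i = κ * S d θ i +
      (θs i - θs 0) * (β * θ i - θ (i + 1) + γ - θ d) := by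
    rcases i with _ | i
    · simp [psi]
    · have := hθ i (by omega)
      rw [psi, if_neg (by omega)]
      simp only [Nat.add_sub_cancel]
      linear_combination (θs (i + 1) - θs 0) * this
  have p1 : psi d κ θ θs (i + 1) = κ * S d θ (i + 1) + (θs (i + 1) - θs 0) * (θ i - θ d) := by
    rw [psi, if_neg (by omega)]; rfl
  have p2 : psi d κ θ θs (i + 2) = κ * S d θ (i + 2) +
      (θs (i + 2) - θs 0) * (θ (i + 1) - θ d) := by
    rw [psi, if_neg (by omega)]; rfl
  have p3 : psi d κ θ θs (i + 3) = κ * S d θ (i + 3) +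
      (β * θs (i + 2) - θs (i + 1) + γs - θs 0) * (θ (i + 2) - θ d) := by
    rcases Nat.lt_or_ge (i + 2) d with h | h
    · have := hs (i + 1) (by omega)
      rw [psi, if_neg (by omega)]
      simp only [show i + 3 - 1 = i + 2 by omega]
      linear_combination (θ (i + 2) - θ d) * this
    · obtain rfl : d = i + 2 := by omega
      rw [psi, if_pos (by omega), S_top]; ring
  have hS := S_rec hθ i hi
  have h1 := hθ i hi
  have h2 := hs i hi
  have e1 : θ (i + 2) = γ + β * θ (i + 1) - θ i := by linear_combination h1
  have e2 : θs (i + 2) = γs + β * θs (i + 1) - θs i := by linear_combination h2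
  simp only [Om, show i + 1 + 1 = i + 2 by omega, show i + 1 + 2 = i + 3 by omega]
  rw [p0, p1, p2, p3, e1, e2]
  linear_combination κ * hS

/-- condition C -/
def CC (d : ℕ) (θ θs φ : ℕ → K) : Prop :=
  φ 1 - φ d = (θ 0 - θ 1) * (θs d - θs 0) + (θ 0 - θ d) * (θs (d - 1) - θs d)

theorem CC_symm {β γ γs : K} {d : ℕ} {θ θs φ : ℕ → K} (hd : 1 ≤ d) (hθ : Rec β γ d θ)
    (hs : Rec β γs d θs) (h : CC d θs θ φ) : CC d θ θs φ := by
  have w := wron β d γ γs θ θs hd hθ hs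
  unfold CC at *
  linear_combination h + w

theorem psi_CC' {d : ℕ} (hd : 1 ≤ d) (κ : K) (θ θs : ℕ → K) : CC d θs θ (psi d κ θ θs) := by
  unfold CC
  rw [psi, psi, if_neg (by omega), if_neg (by omega), S_symm d θ d (by omega),
    show d + 1 - d = 1 by omega]
  simp only [Nat.sub_self]
  ring

theorem delta_zero {β γ c : K} {d : ℕ} {θ δ : ℕ → K} (hd : 2 ≤ d) (hθ : Rec β γ d θ)
    (h0d : θ 0 ≠ θ d) (h1d : θ 1 ≠ θ d) (hδ : Rec β c (d + 1) δ) (z0 : δ 0 = 0) (z1 : δ 1 = 0)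
    (zd : δ d = 0) : ∀ i, i ≤ d + 1 → δ i = 0 := by
  have w := wron β d c γ δ θ (by omega) (fun j hj => hδ j (by omega)) hθ
  have zd1 : δ (d - 1) = 0 := by
    rw [z0, z1, zd] at w
    have : δ (d - 1) * (θ 0 - θ d) = 0 := by linear_combination w
    exact (mul_eq_zero.mp this).resolve_right (sub_ne_zero.mpr h0d)
  have key : ∀ i, i + 2 ≤ d → (c * (θ (i + 1) - θ 1) + (θ 1 - θ 0) * δ i
      - (θ 2 - θ 1) * δ (i + 1) = 0) ∧ (c * (θ (i + 2) - θ 1) + (θ 1 - θ 0) * δ (i + 1)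
      - (θ 2 - θ 1) * δ (i + 2) = 0) := by
    intro i
    induction i with
    | zero =>
      intro _
      have := hδ 0 (by omega)
      simp only [zero_add, z0, z1] at this ⊢
      refine ⟨by ring, ?_⟩
      linear_combination -(θ 2 - θ 1) * this
    | succ i ih =>
      intro hi
      obtain ⟨a, b⟩ := ih (by omega)
      refine ⟨b, ?_⟩
      have r1 := hδ i (by omega)
      have r2 := hδ (i + 1) (by omega)
      have r3 := hθ (i + 1) (by omega)
      have r4 := hθ 0 (by omega)
      simp only [show i + 1 + 1 = i + 2 by omega, show i + 1 + 2 = i + 3 by omega, zero_add]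
        at *
      linear_combination β * b - a + c * r3 - c * r4 + (θ 1 - θ 0) * r1 - (θ 2 - θ 1) * r2
  have c0 : c = 0 := by
    have := (key (d - 2) (by omega)).2
    rw [show d - 2 + 2 = d by omega, show d - 2 + 1 = d - 1 by omega, zd, zd1] at this
    have : c * (θ d - θ 1) = 0 := by linear_combination this
    exact (mul_eq_zero.mp this).resolve_right (sub_ne_zero.mpr h1d.symm)
  intro i
  induction i using Nat.strong_induction_on with
  | _ i ih =>
    intro hi
    obtain rfl | rfl | h : i = 0 ∨ i = 1 ∨ 2 ≤ i := by omega
    · exact z0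
    · exact z1
    · obtain ⟨n, rfl⟩ : ∃ n, i = n + 2 := ⟨i - 2, by omega⟩
      have r := hδ n hi
      have a := ih n (by omega) (by omega)
      have b := ih (n + 1) (by omega) (by omega)
      rw [a, b, c0] at r
      linear_combination r

theorem phi_eq_psi {β γ γs : K} {d : ℕ} {θ θs φ : ℕ → K} (hd : 1 ≤ d) (hθ : Rec β γ d θ)
    (hs : Rec β γs d θs)
    (h0d : θ 0 ≠ θ d) (h1d : 2 ≤ d → θ 1 ≠ θ d) (φ0 : φ 0 = 0)
    (ω : K) (hO : ∀ i, i + 1 ≤ d → Om β γ γs θ θs φ i = ω) (hC : 2 ≤ d → CC d θ θs φ)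
    (κ : K) (hκ : κ * (θ 0 - θ d) = φ 1 - (θs 1 - θs 0) * (θ 0 - θ d)) :
    ∀ i, i ≤ d → φ i = psi d κ θ θs i := by
  have p1 : φ 1 = psi d κ θ θs 1 := by
    rw [psi, if_neg (by omega), S_one]; simp only [Nat.sub_self]
    linear_combination -hκ
  have p0 : φ 0 = psi d κ θ θs 0 := by rw [φ0]; simp [psi]
  rcases Nat.lt_or_ge d 2 with h2 | h2
  · intro i hi
    obtain rfl | rfl : i = 0 ∨ i = 1 := by omega
    · exact p0
    · exact p1
  · have hO' : ∀ i, i + 1 ≤ d → Om β γ γs θ θs (psi d κ θ θs) i =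
        Om β γ γs θ θs (psi d κ θ θs) 0 := by
      intro i
      induction i with
      | zero => intro _; rfl
      | succ i ih => intro hi; rw [psi_Om hθ hs i hi, ih (by omega)]
    have z := delta_zero (δ := fun i => φ i - psi d κ θ θs i)
      (c := ω - Om β γ γs θ θs (psi d κ θ θs) 0) h2 hθ h0d (h1d h2) ?_ ?_ ?_ ?_
    · intro i hi
      exact sub_eq_zero.mp (z i (by omega))
    · intro j hj
      have a := hO j (by omega)
      have b := hO' j (by omega)
      rw [← a, ← b]
      simp only [Om]; ring
    · simp [p0]
    · simp [p1]
    · have a := hC h2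
      have b := CC_symm hd hθ hs (psi_CC' hd κ θ θs)
      unfold CC at a b
      linear_combination p1 + b - a

theorem rho_const {β γ : K} {d : ℕ} {θ : ℕ → K} (hθ : Rec β γ d θ) :
    ∃ ρ, ∀ j, j + 1 ≤ d → θ j ^ 2 - β * θ j * θ (j + 1) + θ (j + 1) ^ 2
      - γ * (θ j + θ (j + 1)) = ρ := by
  refine ⟨θ 0 ^ 2 - β * θ 0 * θ 1 + θ 1 ^ 2 - γ * (θ 0 + θ 1), fun j => ?_⟩
  · induction j with
    | zero => intro _; rfl
    | succ j ih =>
      intro hj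
      rw [← ih (by omega)]
      have := hθ j hj
      linear_combination (θ (j + 2) - θ j) * this

/-- basis functions -/
def U (d : ℕ) (θ : ℕ → K) (j : ℕ) : Fin (d + 1) → K :=
  fun k => ∏ h ∈ Finset.range j, (θ k - θ h)

theorem U_succ (d : ℕ) (θ : ℕ → K) (j : ℕ) (k : Fin (d + 1)) :
    U d θ (j + 1) k = U d θ j k * (θ k - θ j) := Finset.prod_range_succ _ _

theorem U_lt (d : ℕ) (θ : ℕ → K) (j : ℕ) (k : Fin (d + 1)) (h : (k : ℕ) < j) :
    U d θ j k = 0 :=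
  Finset.prod_eq_zero (Finset.mem_range.mpr h) (sub_self _)

theorem U_big (d : ℕ) (θ : ℕ → K) (j : ℕ) (h : d < j) : U d θ j = 0 := by
  ext k; exact U_lt d θ j k (by omega)

/-- core data -/
structure Core (d : ℕ) (θ θs φ : ℕ → K) (t : Matrix (Fin (d + 1)) (Fin (d + 1)) K) : Prop where
  inj : ∀ i j, i ≤ d → j ≤ d → i ≠ j → θ i ≠ θ j
  φ0 : φ 0 = 0
  φd : φ (d + 1) = 0
  act : ∀ j, t *ᵥ U d θ j = θs j • U d θ j + φ j • U d θ (j - 1)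

variable {d : ℕ} {θ θs φ : ℕ → K} {t : Matrix (Fin (d + 1)) (Fin (d + 1)) K}

theorem U_ne (hc : ∀ i j, i ≤ d → j ≤ d → i ≠ j → θ i ≠ θ j) (j : ℕ) (k : Fin (d + 1))
    (h : j ≤ k) : U d θ j k ≠ 0 := by
  refine Finset.prod_ne_zero_iff.mpr fun l hl => sub_ne_zero.mpr (hc _ _ ?_ ?_ ?_)
  all_goals
    rw [Finset.mem_range] at hl
    have := k.2
    omega

theorem upper_aux (hc : Core d θ θs φ t) (n : ℕ) : ∀ m, m + n = d + 1 → ∀ f : Fin (d + 1) → K,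
    (∀ k : Fin (d + 1), (k : ℕ) < m → f k = 0) →
    ∀ k : Fin (d + 1), (k : ℕ) + 1 < m → (t *ᵥ f) k = 0 := by
  induction n with
  | zero =>
    intro m hm f hf k hk
    have : f = 0 := by ext k; exact hf k (by omega)
    simp [this]
  | succ n ih =>
    intro m hm f hf k hk
    have hu := U_ne hc.inj m ⟨m, by omega⟩ le_rfl
    set c := f ⟨m, by omega⟩ / U d θ m ⟨m, by omega⟩ with hcdef
    have h1 := ih (m + 1) (by omega) (f - c • U d θ m) (fun k hk => by
      rcases Nat.lt_or_ge k m with h | h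
      · simp [hf k h, U_lt d θ m k h]
      · have : k = ⟨m, by omega⟩ := Fin.ext (by simp; omega)
        rw [this]
        simp [hcdef, div_mul_cancel₀ _ hu]) k (by omega)
    rw [mulVec_sub, mulVec_smul, hc.act] at h1
    simp only [Pi.sub_apply, Pi.smul_apply, Pi.add_apply, smul_eq_mul,
      U_lt d θ m k (by omega), U_lt d θ (m - 1) k (by omega)] at h1
    simpa using h1

theorem upper_zero (hc : Core d θ θs φ t) (i j : Fin (d + 1)) (h : (i : ℕ) + 1 < j) :
    t i j = 0 := by
  have := upper_aux hc (d + 1 - j) j (by omega) (Pi.single j 1) (fun k hk => by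
    rw [Pi.single_apply, if_neg]; intro e; rw [e] at hk; omega) i h
  simpa using this

theorem upper_adj (hc : Core d θ θs φ t) (i j : Fin (d + 1)) (h : (i : ℕ) + 1 = j) :
    t i j * U d θ j j = φ j * U d θ i i := by
  have hu := U_ne hc.inj j j le_rfl
  have := upper_aux hc (d - j) (j + 1) (by omega)
    (Pi.single j 1 - (1 / U d θ j j) • U d θ j) (fun k hk => by
      rcases Nat.lt_or_ge k j with h | h
      · have : k ≠ j := fun e => by rw [e] at h; omega
        simp [U_lt d θ j k h, this]
      · have : k = j := Fin.ext (by omega)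
        subst this
        simp [hu]) i (by omega)
  rw [mulVec_sub, mulVec_smul, hc.act] at this
  simp only [Pi.sub_apply, Pi.smul_apply, Pi.add_apply, smul_eq_mul,
      U_lt d θ j i (by omega), show (j : ℕ) - 1 = i by omega, mulVec_single_one, col_apply] at this
  field_simp at this
  linear_combination this

/-- polynomials -/
noncomputable def tau (θ : ℕ → K) (j : ℕ) : K[X] := ∏ h ∈ Finset.range j, (X - C (θ h))

theorem tau_monic (θ : ℕ → K) (j : ℕ) : (tau θ j).Monic := monic_prod_X_sub_C _ _

theorem tau_natDegree (θ : ℕ → K) (j : ℕ) : (tau θ j).natDegree = j := by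
  simp [tau]

def ev (d : ℕ) (θ : ℕ → K) (f : K[X]) : Fin (d + 1) → K := fun k => f.eval (θ k)

theorem ev_tau (j : ℕ) : ev d θ (tau θ j) = U d θ j := by
  ext k; simp [ev, tau, U, eval_prod]

theorem tau_coeff (θ : ℕ → K) (j : ℕ) : (tau θ j).coeff j = 1 := by
  have := (tau_monic θ j).coeff_natDegree
  rwa [tau_natDegree] at this

theorem deg_act (hc : Core d θ θs φ t) (n : ℕ) : ∀ f : K[X], f.natDegree ≤ n →
    ∃ g : K[X], g.natDegree ≤ n ∧ g.coeff n = θs n * f.coeff n ∧ t *ᵥ ev d θ f = ev d θ g := by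
  induction n with
  | zero =>
    intro f hf
    refine ⟨C (θs 0 * f.coeff 0), (natDegree_C _).le, by simp, ?_⟩
    have e : ev d θ f = f.coeff 0 • U d θ 0 := by
      ext k
      rw [eq_C_of_natDegree_le_zero hf]
      simp [ev, U]
    rw [e, mulVec_smul, hc.act, hc.φ0]
    ext k
    simp [ev, U]; ring
  | succ n ih =>
    intro f hf
    obtain ⟨g, hg, -, hgt⟩ := ih (f - C (f.coeff (n + 1)) * tau θ (n + 1)) (by
      rw [natDegree_le_iff_coeff_eq_zero]
      intro m hm
      rw [coeff_sub, coeff_C_mul]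
      obtain rfl | h : m = n + 1 ∨ n + 1 < m := by omega
      · rw [tau_coeff]; ring
      · rw [coeff_eq_zero_of_natDegree_lt (by omega), coeff_eq_zero_of_natDegree_lt
          (p := tau θ (n + 1)) (by rw [tau_natDegree]; omega)]; ring)
    refine ⟨g + C (θs (n + 1) * f.coeff (n + 1)) * tau θ (n + 1)
      + C (φ (n + 1) * f.coeff (n + 1)) * tau θ n, ?_, ?_, ?_⟩
    · refine natDegree_add_le_of_degree_le (natDegree_add_le_of_degree_le (by omega) ?_) ?_
      · exact (natDegree_C_mul_le _ _).trans (by rw [tau_natDegree])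
      · exact (natDegree_C_mul_le _ _).trans (by rw [tau_natDegree]; omega)
    · rw [coeff_add, coeff_add, coeff_C_mul, coeff_C_mul, tau_coeff,
        coeff_eq_zero_of_natDegree_lt (p := g) (by omega),
        coeff_eq_zero_of_natDegree_lt (p := tau θ n) (by rw [tau_natDegree]; omega)]
      ring
    · have e : ev d θ (f - C (f.coeff (n + 1)) * tau θ (n + 1)) =
          ev d θ f - f.coeff (n + 1) • U d θ (n + 1) := by
        ext k; simp [← ev_tau, ev]
      rw [e, mulVec_sub, mulVec_smul, hc.act, sub_eq_iff_eq_add] at hgt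
      rw [hgt]
      ext k
      simp [← ev_tau, ev]; ring

theorem ev_inj (hc : ∀ i j, i ≤ d → j ≤ d → i ≠ j → θ i ≠ θ j) (f g : K[X])
    (hf : f.natDegree ≤ d) (hg : g.natDegree ≤ d) (h : ev d θ f = ev d θ g) : f = g := by
  have hi : Function.Injective (fun k : Fin (d + 1) => θ k) := by
    intro a b hab
    by_contra hne
    exact hc a b (by omega) (by omega) (fun e => hne (Fin.ext e)) hab
  have : f - g = 0 := by
    refine eq_zero_of_natDegree_lt_card_of_eval_eq_zero (f - g) hi (fun k => ?_) ?_
    · have := congrFun h k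
      simp only [ev] at this
      simp [this]
    · have := natDegree_sub_le_of_le hf hg
      simp at this ⊢; omega
  exact sub_eq_zero.mp this

theorem ind (hc : ∀ i j, i ≤ d → j ≤ d → i ≠ j → θ i ≠ θ j) (n : ℕ) (hn : n ≤ d) (a : K)
    (g : K[X]) (hg : g.natDegree < n) (h : a • U d θ n + ev d θ g = 0) : a = 0 := by
  have e : C a * tau θ n + g = 0 := by
    refine ev_inj hc _ _ ?_ (by simp) ?_
    · exact natDegree_add_le_of_degree_le ((natDegree_C_mul_le _ _).trans (by rwa [tau_natDegree]))
        (by omega)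
    · rw [← ev_tau] at h
      rw [show ev d θ 0 = 0 by ext k; simp [ev], ← h]
      ext k; simp [ev]
  have := congrArg (fun p => p.coeff n) e
  simp only [coeff_add, coeff_C_mul, tau_coeff, coeff_eq_zero_of_natDegree_lt hg, coeff_zero]
    at this
  linear_combination this

theorem ind4 (hc : ∀ i j, i ≤ d → j ≤ d → i ≠ j → θ i ≠ θ j) (j : ℕ) (hj : j + 1 ≤ d)
    (a b c e : K) (h : a • U d θ (j + 2) + b • U d θ (j + 1) + c • U d θ j
      + e • U d θ (j - 1) = 0) : b = 0 ∧ (j + 2 ≤ d → a = 0) := by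
  have ha : j + 2 ≤ d → a = 0 := by
    intro h2
    refine ind hc (j + 2) h2 a (C b * tau θ (j + 1) + C c * tau θ j + C e * tau θ (j - 1)) ?_ ?_
    · refine Nat.lt_succ_of_le (natDegree_add_le_of_degree_le (natDegree_add_le_of_degree_le ?_ ?_)
        ?_) <;> exact (natDegree_C_mul_le _ _).trans ((tau_natDegree _ _).le.trans (by omega))
    · rw [← h]; ext k; simp [← ev_tau, ev]; ring
  refine ⟨?_, ha⟩
  have ha' : a • U d θ (j + 2) = 0 := by
    by_cases h2 : j + 2 ≤ d
    · rw [ha h2, zero_smul]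
    · rw [U_big d θ _ (by omega), smul_zero]
  rw [ha', zero_add] at h
  refine ind hc (j + 1) hj b (C c * tau θ j + C e * tau θ (j - 1)) ?_ ?_
  · refine Nat.lt_succ_of_le (natDegree_add_le_of_degree_le ?_
        ?_) <;> exact (natDegree_C_mul_le _ _).trans ((tau_natDegree _ _).le.trans (by omega))
  · rw [← h]; ext k; simp [← ev_tau, ev]; ring

/-- diagonal matrix -/
def TH (d : ℕ) (θ : ℕ → K) : Matrix (Fin (d + 1)) (Fin (d + 1)) K :=
  Matrix.diagonal (fun k => θ k)

theorem TH_mulVec (f : Fin (d + 1) → K) (k : Fin (d + 1)) : (TH d θ *ᵥ f) k = θ k * f k := by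
  simp [TH, mulVec_diagonal]

theorem TH_U (j : ℕ) : TH d θ *ᵥ U d θ j = U d θ (j + 1) + θ j • U d θ j := by
  ext k
  rw [TH_mulVec]
  simp only [Pi.add_apply, Pi.smul_apply, smul_eq_mul, U_succ]
  ring

/-- the Askey--Wilson expression -/
def AW (d : ℕ) (θ : ℕ → K) (t : Matrix (Fin (d + 1)) (Fin (d + 1)) K) (β γ γs ρ ω η : K) :
    Matrix (Fin (d + 1)) (Fin (d + 1)) K :=
  TH d θ * (TH d θ * t) - β • (TH d θ * (t * TH d θ)) + t * (TH d θ * TH d θ)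
    - γ • (TH d θ * t + t * TH d θ) - ρ • t - γs • (TH d θ * TH d θ) - ω • TH d θ - η • 1

theorem AW_apply (β γ γs ρ ω η : K) (i j : Fin (d + 1)) (h : i ≠ j) :
    AW d θ t β γ γs ρ ω η i j =
      (θ i ^ 2 - β * θ i * θ j + θ j ^ 2 - γ * (θ i + θ j) - ρ) * t i j := by
  simp [AW, TH, h, diagonal_mul, mul_diagonal, ← mul_assoc]
  ring

def dg (θ θs φ : ℕ → K) (β γ γs ρ ω : K) (j : ℕ) : K :=
  2 * θ j ^ 2 * θs j + (θ j + θ (j - 1)) * φ j + (θ j + θ (j + 1)) * φ (j + 1)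
    - β * (θ j ^ 2 * θs j + θ j * (φ j + φ (j + 1))) - γ * (2 * θ j * θs j + φ j + φ (j + 1))
    - ρ * θs j - γs * θ j ^ 2 - ω * θ j

theorem AW_U (hc : Core d θ θs φ t) (β γ γs ρ ω η : K) (j : ℕ) :
    AW d θ t β γ γs ρ ω η *ᵥ U d θ j =
      (θs j - β * θs (j + 1) + θs (j + 2) - γs) • U d θ (j + 2)
      + (Om β γ γs θ θs φ j - ω) • U d θ (j + 1)
      + (dg θ θs φ β γ γs ρ ω j - η) • U d θ j
      + (φ j * (θ (j - 1) ^ 2 - β * θ (j - 1) * θ j + θ j ^ 2 - γ * (θ (j - 1) + θ j) - ρ))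
        • U d θ (j - 1) := by
  ext k
  simp only [AW, sub_mulVec, add_mulVec, smul_mulVec, ← mulVec_mulVec, TH_U, mulVec_add,
    mulVec_smul, hc.act, one_mulVec, Pi.sub_apply, Pi.add_apply, Pi.smul_apply, smul_eq_mul,
    TH_mulVec, Nat.add_sub_cancel]
  rcases j with _ | j
  · simp only [hc.φ0, U_succ, Om, dg, Nat.zero_add, Nat.zero_sub]
    simp only [Nat.reduceAdd]
    ring
  · simp only [Nat.add_sub_cancel, U_succ, Om, dg, show j + 1 + 1 = j + 2 from rfl, show j + 1 + 2 = j + 3 from rfl, show j + 2 + 1 = j + 3 from rfl, show j + 3 - 1 = j + 2 from rfl, show j + 2 - 1 = j + 1 from rfl]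
    ring

theorem AW_zero_of (hc : ∀ i j, i ≤ d → j ≤ d → i ≠ j → θ i ≠ θ j)
    (M : Matrix (Fin (d + 1)) (Fin (d + 1)) K) (h : ∀ j, j ≤ d → M *ᵥ U d θ j = 0) : M = 0 := by
  have key : ∀ n m, m + n = d + 1 → ∀ f : Fin (d + 1) → K,
      (∀ k : Fin (d + 1), (k : ℕ) < m → f k = 0) → M *ᵥ f = 0 := by
    intro n
    induction n with
    | zero =>
      intro m hm f hf
      have : f = 0 := by ext k; exact hf k (by omega)
      simp [this]
    | succ n ih =>
      intro m hm f hf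
      have hu := U_ne hc m ⟨m, by omega⟩ le_rfl
      set c := f ⟨m, by omega⟩ / U d θ m ⟨m, by omega⟩ with hcdef
      have h1 := ih (m + 1) (by omega) (f - c • U d θ m) (fun k hk => by
        rcases Nat.lt_or_ge k m with h | h
        · simp [hf k h, U_lt d θ m k h]
        · have : k = ⟨m, by omega⟩ := Fin.ext (by simp; omega)
          rw [this]
          simp [hcdef, div_mul_cancel₀ _ hu])
      rwa [mulVec_sub, mulVec_smul, h m (by omega), smul_zero, sub_zero] at h1
  ext i j
  have := congrFun (key (d + 1) 0 (by omega) (Pi.single j 1) (by intro k hk; omega)) i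
  simpa using this

theorem dg_const (φ0 : φ 0 = 0) (φd : φ (d + 1) = 0) {β γ γs ρ ω : K} (hθ : Rec β γ d θ)
    (hρ : ∀ j, j + 1 ≤ d → θ j ^ 2 - β * θ j * θ (j + 1) + θ (j + 1) ^ 2
      - γ * (θ j + θ (j + 1)) = ρ)
    (hO : ∀ j, j + 1 ≤ d → Om β γ γs θ θs φ j = ω) (j : ℕ) (hj : j ≤ d) :
    dg θ θs φ β γ γs ρ ω j = dg θ θs φ β γ γs ρ ω 0 := by
  induction j with
  | zero => rfl
  | succ j ih =>
    rw [← ih (by omega)]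
    have h1 : φ j * θ (j - 1) = φ j * (β * θ j + γ - θ (j + 1)) := by
      rcases j with _ | j
      · rw [φ0]; ring
      · have := hθ j (by omega)
        simp only [Nat.add_sub_cancel]
        linear_combination φ (j + 1) * this
    have h2 : φ (j + 2) * θ (j + 2) = φ (j + 2) * (β * θ (j + 1) + γ - θ j) := by
      by_cases h : j + 2 ≤ d
      · have := hθ j (by omega)
        linear_combination φ (j + 2) * this
      · rw [show j + 2 = d + 1 by omega, φd]; ring
    have h3 := hρ j hj
    have h4 := hO j hj
    unfold Om at h4
    simp only [dg, Nat.add_sub_cancel, show j + 1 + 1 = j + 2 from rfl]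
    linear_combination h2 - h1 + (θ (j + 1) - θ j) * h4 + (θs (j + 1) - θs j) * h3

theorem AW_zero (hc : Core d θ θs φ t) {β γ γs ρ ω : K} (hθ : Rec β γ d θ) (hs : Rec β γs d θs)
    (hρ : ∀ j, j + 1 ≤ d → θ j ^ 2 - β * θ j * θ (j + 1) + θ (j + 1) ^ 2
      - γ * (θ j + θ (j + 1)) = ρ)
    (hO : ∀ j, j + 1 ≤ d → Om β γ γs θ θs φ j = ω) :
    AW d θ t β γ γs ρ ω (dg θ θs φ β γ γs ρ ω 0) = 0 := by
  refine AW_zero_of hc.inj _ fun j hj => ?_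
  rw [AW_U hc, dg_const hc.φ0 hc.φd hθ hρ hO j hj, sub_self, zero_smul]
  have e1 : (θs j - β * θs (j + 1) + θs (j + 2) - γs) • U d θ (j + 2) = 0 := by
    by_cases h : j + 2 ≤ d
    · rw [← hs j h, show θs j - β * θs (j + 1) + θs (j + 2) -
        (θs (j + 2) - β * θs (j + 1) + θs j) = 0 by ring, zero_smul]
    · rw [U_big d θ _ (by omega), smul_zero]
  have e2 : (Om β γ γs θ θs φ j - ω) • U d θ (j + 1) = 0 := by
    by_cases h : j + 1 ≤ d
    · rw [hO j h, sub_self, zero_smul]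
    · rw [U_big d θ _ (by omega), smul_zero]
  have e3 : φ j * (θ (j - 1) ^ 2 - β * θ (j - 1) * θ j + θ j ^ 2 - γ * (θ (j - 1) + θ j) - ρ)
      = 0 := by
    rcases j with _ | j
    · rw [hc.φ0, zero_mul]
    · rw [← hρ j hj]; simp
  rw [e1, e2, e3]; simp

/-- lower entries vanish, except possibly the corner -/
theorem lower_zero (hc : Core d θ θs φ t) {β γ γs ω : K} (hθ : Rec β γ d θ) (hs : Rec β γs d θs)
    (hO : ∀ j, j + 1 ≤ d → Om β γ γs θ θs φ j = ω) (i j : Fin (d + 1)) (hij : (j : ℕ) + 1 < i)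
    (hne : ¬ ((j : ℕ) = 0 ∧ (i : ℕ) = d)) : t i j = 0 := by
  obtain ⟨ρ, hρ⟩ := rho_const hθ
  have h0 := AW_zero hc hθ hs hρ hO
  have h1 := congrFun (congrFun h0 i) j
  rw [AW_apply _ _ _ _ _ _ _ _ (fun e => by rw [e] at hij; omega)] at h1
  refine (mul_eq_zero.mp h1).resolve_left ?_
  have ni := i.2
  by_cases hj : (j : ℕ) = 0
  · have hid : (i : ℕ) + 1 ≤ d := by omega
    obtain ⟨n, hn⟩ : ∃ n, (i : ℕ) = n + 1 := ⟨i - 1, by omega⟩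
    rw [hn]
    have := hθ n (by omega)
    have e := hρ n (by omega)
    rw [show θ (n + 1) ^ 2 - β * θ (n + 1) * θ j + θ j ^ 2 - γ * (θ (n + 1) + θ j) - ρ
      = (θ j - θ n) * (θ j - θ (n + 2)) by linear_combination e + (θ j - θ n) * this]
    exact mul_ne_zero (sub_ne_zero.mpr (hc.inj _ _ (by omega) (by omega) (by omega)))
      (sub_ne_zero.mpr (hc.inj _ _ (by omega) (by omega) (by omega)))
  · obtain ⟨n, hn⟩ : ∃ n, (j : ℕ) = n + 1 := ⟨j - 1, by omega⟩
    rw [hn]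
    have := hθ n (by omega)
    have e := hρ n (by omega)
    rw [show θ i ^ 2 - β * θ i * θ (n + 1) + θ (n + 1) ^ 2 - γ * (θ i + θ (n + 1)) - ρ
      = (θ i - θ n) * (θ i - θ (n + 2)) by linear_combination e + (θ i - θ n) * this]
    exact mul_ne_zero (sub_ne_zero.mpr (hc.inj _ _ (by omega) (by omega) (by omega)))
      (sub_ne_zero.mpr (hc.inj _ _ (by omega) (by omega) (by omega)))

theorem poly_zero (hc : ∀ i j, i ≤ d → j ≤ d → i ≠ j → θ i ≠ θ j) (f : K[X]) (s : Finset ℕ)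
    (hs : ∀ k ∈ s, k ≤ d ∧ f.eval (θ k) = 0) (hdeg : f.natDegree < s.card) : f = 0 := by
  refine eq_zero_of_natDegree_lt_card_of_eval_eq_zero (ι := s) f (f := fun k => θ k) ?_ ?_ ?_
  · intro a b hab
    by_contra hne
    exact hc a b (hs _ a.2).1 (hs _ b.2).1 (fun e => hne (Subtype.ext e)) hab
  · exact fun k => (hs _ k.2).2
  · simpa using hdeg

theorem row_zero (hc : Core d θ θs φ t) (hd : 1 ≤ d) (f : K[X]) :
    (t *ᵥ ev d θ f) 0 * (θ 1 - θ 0) = θs 0 * f.eval (θ 0) * (θ 1 - θ 0)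
      + φ 1 * (f.eval (θ 1) - f.eval (θ 0)) := by
  have hne := sub_ne_zero.mpr (hc.inj 1 0 (by omega) (by omega) (by omega))
  have := upper_aux hc (d - 1) 2 (by omega) (ev d θ f - f.eval (θ 0) • U d θ 0
    - ((f.eval (θ 1) - f.eval (θ 0)) / (θ 1 - θ 0)) • U d θ 1) (fun k hk => by
      obtain h | h : (k : ℕ) = 0 ∨ (k : ℕ) = 1 := by omega
      · simp [ev, U, h]
      · simp [ev, U, h, div_mul_cancel₀ _ hne]) 0 (by simp)
  rw [mulVec_sub, mulVec_sub, mulVec_smul, mulVec_smul, hc.act, hc.act, hc.φ0] at this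
  simp [U] at this
  field_simp at this
  linear_combination this

noncomputable def etaP (d : ℕ) (θ : ℕ → K) (j : ℕ) : K[X] :=
  ∏ h ∈ Finset.range j, (X - C (θ (d - h)))

theorem etaP_natDegree (d : ℕ) (θ : ℕ → K) (j : ℕ) : (etaP d θ j).natDegree = j := by
  simp [etaP]

theorem etaP_coeff (d : ℕ) (θ : ℕ → K) (j : ℕ) : (etaP d θ j).coeff j = 1 := by
  have h : (etaP d θ j).Monic := monic_prod_X_sub_C _ _
  have := h.coeff_natDegree
  rwa [etaP_natDegree] at this

theorem etaP_eval (d : ℕ) (θ : ℕ → K) (j : ℕ) (x : K) : (etaP d θ j).eval x = eta d θ j x := by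
  simp [etaP, eta, eval_prod]

theorem eta_zero (d : ℕ) (θ : ℕ → K) (j k : ℕ) (h : d < k + j) (hk : k ≤ d) :
    eta d θ j (θ k) = 0 :=
  Finset.prod_eq_zero (Finset.mem_range.mpr (show d - k < j by omega))
    (by rw [show d - (d - k) = k by omega, sub_self])

theorem eta_ne (hc : ∀ i j, i ≤ d → j ≤ d → i ≠ j → θ i ≠ θ j) (j k : ℕ) (h : k + j ≤ d) :
    eta d θ j (θ k) ≠ 0 := by
  refine Finset.prod_ne_zero_iff.mpr fun l hl => sub_ne_zero.mpr (hc _ _ ?_ ?_ ?_)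
  all_goals
    rw [Finset.mem_range] at hl
    omega

theorem lemmaN (hc : Core d θ θs φ t) {β γ : K} (hθ : Rec β γ d θ)
    (hlow : ∀ k l : Fin (d + 1), (l : ℕ) + 1 < k → t k l = 0) (i : ℕ) (hi : 1 ≤ i) (hid : i ≤ d)
    (k l : Fin (d + 1)) (hk : (k : ℕ) = d - i + 1) (hl : (l : ℕ) = d - i) :
    t k l * eta d θ i (θ l) = (φ 1 * S d θ i / (θ 0 - θ d)
      + (θs i - θs 0) * (θ (d - i + 1) - θ 0)) * eta d θ (i - 1) (θ k) := by
  obtain ⟨n, rfl⟩ : ∃ n, i = n + 1 := ⟨i - 1, by omega⟩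
  obtain ⟨g, hg, hgc, hgt⟩ := deg_act hc (n + 1) (etaP d θ (n + 1)) (etaP_natDegree _ _ _).le
  rw [etaP_coeff, mul_one] at hgc
  set Y := g - C (θs (n + 1)) * etaP d θ (n + 1) with hY
  have hYd : Y.natDegree ≤ n := by
    rw [natDegree_le_iff_coeff_eq_zero]
    intro m hm
    rw [hY, coeff_sub, coeff_C_mul]
    obtain rfl | h : m = n + 1 ∨ n + 1 < m := by omega
    · rw [etaP_coeff, hgc]; ring
    · rw [coeff_eq_zero_of_natDegree_lt (by omega), coeff_eq_zero_of_natDegree_lt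
          (p := etaP d θ (n + 1)) (by rw [etaP_natDegree]; omega)]; ring
  have hYe : ∀ m : Fin (d + 1), Y.eval (θ m) =
      (t *ᵥ ev d θ (etaP d θ (n + 1))) m - θs (n + 1) * eta d θ (n + 1) (θ m) := by
    intro m
    rw [hgt, hY]; simp [ev, etaP_eval]
  have hYk : Y.eval (θ k) = t k l * eta d θ (n + 1) (θ l) := by
    rw [hYe, eta_zero d θ (n + 1) k (by omega) (by omega), mul_zero, sub_zero, mulVec, dotProduct,
      Finset.sum_eq_single l]
    · simp [ev, etaP_eval]
    · intro b _ hb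
      have hb' : (b : ℕ) ≠ l := fun e => hb (Fin.ext e)
      by_cases h : (b : ℕ) + 1 < k
      · rw [hlow _ _ h, zero_mul]
      · simp only [ev, etaP_eval]
        rw [eta_zero d θ (n + 1) b (by omega) (by omega), mul_zero]
    · simp
  have hek := eta_ne hc.inj n k (by omega)
  set c := Y.eval (θ k) / eta d θ n (θ k) with hcd
  have hz : Y - C c * etaP d θ n = 0 := by
    refine poly_zero hc.inj _ (Finset.Icc (d - n) d) (fun m hm => ?_) ?_
    · rw [Finset.mem_Icc] at hm
      refine ⟨hm.2, ?_⟩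
      rw [eval_sub, eval_mul, eval_C, etaP_eval]
      by_cases h : m = k
      · rw [h, hcd, div_mul_cancel₀ _ hek, sub_self]
      · rw [eta_zero d θ n m (by omega) hm.2, mul_zero, sub_zero]
        have := hYe ⟨m, by omega⟩
        simp only at this
        rw [this, eta_zero d θ (n + 1) m (by omega) hm.2, mul_zero, sub_zero, mulVec, dotProduct]
        refine Finset.sum_eq_zero fun b _ => ?_
        by_cases h : (b : ℕ) + 1 < m
        · rw [hlow _ _ h, zero_mul]
        · simp only [ev, etaP_eval]
          rw [eta_zero d θ (n + 1) b (by omega) (by omega), mul_zero]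
    · rw [Nat.card_Icc]
      have : (Y - C c * etaP d θ n).natDegree ≤ n :=
        (natDegree_sub_le_of_le hYd
          ((natDegree_C_mul_le _ _).trans (etaP_natDegree d θ n).le)).trans (max_self n).le
      omega
  have hz0 := congrArg (eval (θ 0)) hz
  rw [eval_sub, eval_mul, eval_C, etaP_eval, eval_zero] at hz0
  have h0 := hYe 0
  simp only [Fin.val_zero] at h0
  have hr := row_zero hc (by omega) (etaP d θ (n + 1))
  rw [etaP_eval, etaP_eval] at hr
  have hid' := eta_ident hθ n hid
  have n01 := sub_ne_zero.mpr (hc.inj 1 0 (by omega) (by omega) (by omega))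
  have n0d := sub_ne_zero.mpr (hc.inj 0 d (by omega) (by omega) (by omega))
  have e0 := eta_ne hc.inj n 0 (by omega)
  have es := eta_succ d θ n (θ 0)
  rw [show θ (d - (n + 1) + 1) = θ (d - n) by congr 1; omega, Nat.add_sub_cancel]
  have hcv : c = φ 1 * S d θ (n + 1) / (θ 0 - θ d) + (θs (n + 1) - θs 0) * (θ (d - n) - θ 0) := by
    refine mul_right_cancel₀ (mul_ne_zero (mul_ne_zero e0 n01) n0d) ?_
    have h2 : φ 1 * S d θ (n + 1) / (θ 0 - θ d) * (θ 0 - θ d) = φ 1 * S d θ (n + 1) :=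
      div_mul_cancel₀ _ n0d
    rw [← sub_eq_zero]
    set q := φ 1 * S d θ (n + 1) / (θ 0 - θ d)
    linear_combination (-(θ 1 - θ 0) * (θ 0 - θ d)) * hz0 + (θ 1 - θ 0) * (θ 0 - θ d) * h0
      + (θ 0 - θ d) * hr - φ 1 * hid' - (θ 1 - θ 0) * eta d θ n (θ 0) * h2
      + (θs 0 - θs (n + 1)) * (θ 1 - θ 0) * (θ 0 - θ d) * es
  rw [← hcv, ← hYk, hcd, div_mul_cancel₀ _ hek]

theorem etaP_sub_tau (n : ℕ) (θ : ℕ → K) :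
    etaP (n + 1) θ (n + 1) = tau θ (n + 1) + C (θ 0 - θ (n + 1)) *
      ∏ h ∈ Finset.range n, (X - C (θ (h + 1))) := by
  have e : etaP (n + 1) θ (n + 1) = ∏ h ∈ Finset.range (n + 1), (X - C (θ (h + 1))) := by
    rw [etaP, ← Finset.prod_range_reflect]
    refine Finset.prod_congr rfl fun h hh => ?_
    rw [Finset.mem_range] at hh
    rw [show n + 1 - (n + 1 - 1 - h) = h + 1 by omega]
  rw [e, Finset.prod_range_succ, tau, Finset.prod_range_succ', C_sub]
  ring

theorem corner_iff (hc : Core d θ θs φ t) (hd : 2 ≤ d)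
    (hlow : ∀ k l : Fin (d + 1), (l : ℕ) + 1 < k → ¬ ((l : ℕ) = 0 ∧ (k : ℕ) = d) → t k l = 0) :
    t (Fin.last d) 0 = 0 ↔ CC d θ θs φ := by
  obtain ⟨n, hdn⟩ : ∃ n, d = n + 1 := ⟨d - 1, by omega⟩
  set r : K[X] := C (θ 0 - θ d) * ∏ h ∈ Finset.range n, (X - C (θ (h + 1))) with hr
  have hmon : (∏ h ∈ Finset.range n, (X - C (θ (h + 1)))).Monic := monic_prod_X_sub_C _ _
  have hnd : (∏ h ∈ Finset.range n, (X - C (θ (h + 1)))).natDegree = n := by simp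
  have hco := hmon.coeff_natDegree
  rw [hnd] at hco
  have hrd : r.natDegree ≤ n := (natDegree_C_mul_le _ _).trans hnd.le
  have hrc : r.coeff n = θ 0 - θ d := by rw [hr, coeff_C_mul, hco, mul_one]
  have het : etaP d θ d = tau θ d + r := by
    have := etaP_sub_tau n θ
    rw [← hdn] at this
    exact this
  clear_value r
  obtain ⟨g, hg, hgc, hgt⟩ := deg_act hc n r hrd
  rw [hrc] at hgc
  set Y := C (φ d) * tau θ n + g - C (θs d) * r with hY
  have hYe : ∀ m : Fin (d + 1), Y.eval (θ m) =
      (t *ᵥ ev d θ (etaP d θ d)) m - θs d * eta d θ d (θ m) := by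
    intro m
    rw [← etaP_eval, show ev d θ (etaP d θ d) = U d θ d + ev d θ r by
      rw [het, ← ev_tau]; ext k; simp [ev], mulVec_add, hc.act, hgt, het, hY]
    simp only [Pi.add_apply, Pi.smul_apply, smul_eq_mul, ← ev_tau, ev, eval_sub, eval_add,
      eval_mul, eval_C, show d - 1 = n by omega]
    ring
  set lead := φ d + (θ 0 - θ d) * (θs n - θs d) with hlead
  set Z := Y - C lead * etaP d θ n with hZ
  have hZd : Z.natDegree < n := by
    refine lt_of_le_of_lt (b := n - 1) ?_ (by omega)
    rw [natDegree_le_iff_coeff_eq_zero]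
    intro m hm
    rw [hZ, hY, coeff_sub, coeff_sub, coeff_add, coeff_C_mul, coeff_C_mul, coeff_C_mul]
    obtain rfl | h : m = n ∨ n < m := by omega
    · rw [etaP_coeff, hgc, hrc, tau_coeff, hlead]; ring
    · rw [coeff_eq_zero_of_natDegree_lt (p := etaP d θ n) (by rw [etaP_natDegree]; omega),
        coeff_eq_zero_of_natDegree_lt (p := tau θ n) (by rw [tau_natDegree]; omega),
        coeff_eq_zero_of_natDegree_lt (p := r) (by omega),
        coeff_eq_zero_of_natDegree_lt (p := g) (by omega)]
      ring
  have hmid : ∀ m, 2 ≤ m → m < d → Z.eval (θ m) = 0 := by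
    intro m h2 hm
    rw [hZ, eval_sub, eval_mul, eval_C, etaP_eval]
    have := hYe ⟨m, by omega⟩
    simp only at this
    rw [this, eta_zero d θ d m (by omega) hm.le, eta_zero d θ n m (by omega) hm.le, mul_zero,
      mul_zero, sub_zero, sub_zero, mulVec, dotProduct]
    refine Finset.sum_eq_zero fun b _ => ?_
    by_cases h : (b : ℕ) = 0
    · rw [hlow _ _ (by simp only; omega) (by simp only; omega), zero_mul]
    · simp only [ev, etaP_eval]
      rw [eta_zero d θ d b (by omega) (by omega), mul_zero]
  have hZl : Z.eval (θ d) = t (Fin.last d) 0 * eta d θ d (θ 0) := by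
    rw [hZ, eval_sub, eval_mul, eval_C, etaP_eval]
    have := hYe (Fin.last d)
    simp only [Fin.val_last] at this
    rw [this, eta_zero d θ d d (by omega) le_rfl, eta_zero d θ n d (by omega) le_rfl, mul_zero,
      mul_zero, sub_zero, sub_zero, mulVec, dotProduct, Finset.sum_eq_single 0]
    · simp [ev, etaP_eval]
    · intro b _ hb
      have hb' : (b : ℕ) ≠ 0 := fun e => hb (Fin.ext e)
      simp only [ev, etaP_eval]
      rw [eta_zero d θ d b (by omega) (by omega), mul_zero]
    · simp
  have hZ0 : Z.eval (θ 0) * (θ 1 - θ 0) = (φ 1 - φ d - ((θ 0 - θ 1) * (θs d - θs 0)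
      + (θ 0 - θ d) * (θs n - θs d))) * (eta d θ n (θ 0) * (θ 1 - θ 0)) := by
    have h0 := hYe 0
    simp only [Fin.val_zero] at h0
    have hr := row_zero hc (by omega) (etaP d θ d)
    rw [etaP_eval, etaP_eval, eta_zero d θ d 1 (by omega) (by omega)] at hr
    have es := eta_succ d θ n (θ 0)
    rw [show d - n = 1 by omega, show n + 1 = d by omega] at es
    rw [es] at h0 hr
    rw [hZ, eval_sub, eval_mul, eval_C, etaP_eval, hlead, h0]
    linear_combination hr
  have n01 := sub_ne_zero.mpr (hc.inj 1 0 (by omega) (by omega) (by omega))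
  have e0 := eta_ne hc.inj n 0 (by omega)
  have ed := eta_ne hc.inj d 0 (by omega)
  unfold CC
  rw [show d - 1 = n by omega]
  constructor
  · intro h
    rw [h, zero_mul] at hZl
    have : Z = 0 := by
      refine poly_zero hc.inj Z (Finset.Icc 2 d) (fun m hm => ?_) (by rw [Nat.card_Icc]; omega)
      rw [Finset.mem_Icc] at hm
      refine ⟨hm.2, ?_⟩
      rcases hm.2.lt_or_eq with h | h
      · exact hmid m hm.1 h
      · rw [h, hZl]
    rw [this, eval_zero, zero_mul] at hZ0
    exact sub_eq_zero.mp ((mul_eq_zero.mp hZ0.symm).resolve_right (mul_ne_zero e0 n01))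
  · intro h
    rw [h, sub_self, zero_mul] at hZ0
    have : Z = 0 := by
      refine poly_zero hc.inj Z (insert 0 (Finset.Ico 2 d)) (fun m hm => ?_)
        (by rw [Finset.card_insert_of_notMem (by simp), Nat.card_Ico]; omega)
      rw [Finset.mem_insert, Finset.mem_Ico] at hm
      rcases hm with rfl | hm
      · exact ⟨by omega, (mul_eq_zero.mp hZ0).resolve_right n01⟩
      · exact ⟨by omega, hmid m hm.1 hm.2⟩
    rw [this, eval_zero] at hZl
    exact (mul_eq_zero.mp hZl.symm).resolve_right ed

/-- nice : irreducible tridiagonal -/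
def Irr (t : Matrix (Fin (d + 1)) (Fin (d + 1)) K) : Prop :=
  ∀ i j : Fin (d + 1),
      (1 < |((i : ℕ) : ℤ) - ((j : ℕ) : ℤ)| → t i j = 0) ∧
      (|((i : ℕ) : ℤ) - ((j : ℕ) : ℤ)| = 1 → t i j ≠ 0)

/-- the second split sequence -/
def phip (d : ℕ) (θ θs φ : ℕ → K) (i : ℕ) : K :=
  φ 1 * S d θ i / (θ 0 - θ d) + (θs i - θs 0) * (θ (d - i + 1) - θ 0)

theorem backward_half (hc : Core d θ θs φ t) {β γ γs ω : K} (hθ : Rec β γ d θ)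
    (hs : Rec β γs d θs) (hO : ∀ j, j + 1 ≤ d → Om β γ γs θ θs φ j = ω)
    (hC : 2 ≤ d → CC d θ θs φ) (hφ : ∀ i, 1 ≤ i → i ≤ d → φ i ≠ 0)
    (hφp : ∀ i, 1 ≤ i → i ≤ d → phip d θ θs φ i ≠ 0) : Irr t := by
  have hlow' : ∀ k l : Fin (d + 1), (l : ℕ) + 1 < k → ¬ ((l : ℕ) = 0 ∧ (k : ℕ) = d) → t k l = 0 :=
    fun k l h h' => lower_zero hc hθ hs hO k l h h'
  have hlow : ∀ k l : Fin (d + 1), (l : ℕ) + 1 < k → t k l = 0 := by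
    intro k l h
    by_cases h' : (l : ℕ) = 0 ∧ (k : ℕ) = d
    · rw [show l = 0 from Fin.ext h'.1, show k = Fin.last d from Fin.ext h'.2]
      exact (corner_iff hc (by omega) hlow').mpr (hC (by omega))
    · exact hlow' k l h h'
  intro i j
  constructor
  · intro h
    rw [lt_abs] at h
    by_cases h' : (j : ℕ) + 1 < i
    · exact hlow i j h'
    · exact upper_zero hc i j (by omega)
  · intro h
    rw [abs_eq (by norm_num)] at h
    by_cases h' : (i : ℕ) + 1 = j
    · intro e
      have := upper_adj hc i j h'
      rw [e, zero_mul] at this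
      exact mul_ne_zero (hφ j (by omega) (by omega)) (U_ne hc.inj i i le_rfl) this.symm
    · intro e
      have := lemmaN hc hθ hlow (d - j) (by omega) (by omega) i j (by omega) (by omega)
      rw [e, zero_mul] at this
      exact mul_ne_zero (hφp (d - j) (by omega) (by omega)) (eta_ne hc.inj _ _ (by omega)) this.symm

theorem exists_beta (hc : Core d θ θs φ t) (ht : Irr t)
    (hsi : ∀ i j, i ≤ d → j ≤ d → i ≠ j → θs i ≠ θs j) : ∃ β γ : K, Rec β γ d θ := by
  by_cases hd : d ≤ 2
  · refine ⟨0, θ 2 + θ 0, fun j hj => ?_⟩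
    obtain rfl : j = 0 := by omega
    simp
  push Not at hd
  let v : ℕ → K := fun n => ∑ h ∈ Finset.range n, -(θ h * θ (h + 1) * (θ h - θ (h + 1)))
  have hv : ∀ i, v i - v (i + 1) = θ i * θ (i + 1) * (θ i - θ (i + 1)) := by
    intro i; simp only [v, Finset.sum_range_succ]; ring
  have hinj : Set.InjOn θ (Finset.range (d + 1) : Finset ℕ) := by
    intro a ha b hb hab
    simp only [Finset.coe_range, Set.mem_Iio] at ha hb
    by_contra hne
    exact hc.inj a b (by omega) (by omega) hne hab
  set p := Lagrange.interpolate (Finset.range (d + 1)) θ v with hp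
  have hpe : ∀ i, i ≤ d → p.eval (θ i) = v i := fun i hi =>
    Lagrange.eval_interpolate_at_node v hinj (Finset.mem_range.mpr (by omega))
  have hpd : p.natDegree ≤ d := by
    have := Lagrange.degree_interpolate_le v hinj
    rw [Finset.card_range] at this
    exact natDegree_le_of_degree_le this
  clear_value p
  have hstep : ∀ i, i + 1 ≤ d → p.eval (θ i) - p.eval (θ (i + 1)) =
      θ i * θ (i + 1) * (θ i - θ (i + 1)) := fun i hi => by
    rw [hpe i (by omega), hpe _ hi, hv]
  -- entrywise identity
  have hent : ∀ i j : Fin (d + 1), θ i * θ j * (θ i - θ j) * t i j =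
      (p.eval (θ i) - p.eval (θ j)) * t i j := by
    intro i j
    by_cases h1 : 1 < |((i : ℕ) : ℤ) - ((j : ℕ) : ℤ)|
    · rw [(ht i j).1 h1]; ring
    · rw [lt_abs] at h1
      obtain h | h | h : (i : ℕ) = j ∨ (i : ℕ) + 1 = j ∨ (j : ℕ) + 1 = i := by omega
      · rw [h]; ring
      · rw [← h, hstep i (by omega)]
      · have := hstep j (by omega)
        rw [← h]
        linear_combination t i j * this
  obtain ⟨g1, d1, c1, e1⟩ := deg_act hc 1 X natDegree_X_le
  obtain ⟨g2, d2, c2, e2⟩ := deg_act hc 2 (X ^ 2) (natDegree_X_pow_le 2)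
  have hpoly : ∀ n, n ≤ d → ∀ g : K[X], g.natDegree ≤ n → p.natDegree ≤ n →
      t *ᵥ ev d θ p = ev d θ g → X ^ 2 * g1 - X * g2 = C (θs 0) * p - g := by
    intro n hn g hg hpn e
    refine ev_inj hc.inj _ _ ?_ ?_ ?_
    · refine natDegree_sub_le_of_le (m := d) (n := d) ?_ ?_ |>.trans (max_self d).le
      · exact natDegree_mul_le_of_le (natDegree_X_pow_le 2) d1 |>.trans (by omega)
      · exact natDegree_mul_le_of_le natDegree_X_le d2 |>.trans (by omega)
    · exact natDegree_sub_le_of_le (m := d) (n := d) ((natDegree_C_mul_le _ _).trans hpd)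
        (by omega) |>.trans (max_self d).le
    · ext k
      have s0 : ∑ j, t k j = θs 0 := by
        have := congrFun (hc.act 0) k
        simpa [mulVec, dotProduct, U, hc.φ0] using this
      have s1 := congrFun e1 k
      have s2 := congrFun e2 k
      have s3 := congrFun e k
      simp only [mulVec, dotProduct, ev, eval_X, eval_pow] at s1 s2 s3
      simp only [ev, eval_sub, eval_mul, eval_pow, eval_X, eval_C, ← s1, ← s2, ← s3, ← s0]
      rw [Finset.mul_sum, Finset.mul_sum, Finset.sum_mul, ← Finset.sum_sub_distrib,
        ← Finset.sum_sub_distrib]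
      refine Finset.sum_congr rfl fun j _ => ?_
      linear_combination hent k j
  have hc3 : ∀ n, 4 ≤ n → (X ^ 2 * g1 - X * g2).coeff n = 0 := by
    intro n hn
    refine coeff_eq_zero_of_natDegree_lt (lt_of_le_of_lt (b := 3) ?_ (by omega))
    refine natDegree_sub_le_of_le (m := 3) (n := 3) ?_ ?_ |>.trans (max_self 3).le
    · exact natDegree_mul_le_of_le (natDegree_X_pow_le 2) d1
    · exact natDegree_mul_le_of_le natDegree_X_le d2
  have hp3 : p.natDegree ≤ 3 := by
    by_contra hlt
    push Not at hlt
    obtain ⟨g, dg, cg, eg⟩ := deg_act hc p.natDegree p le_rfl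
    have h := congrArg (fun q => q.coeff p.natDegree) (hpoly _ hpd g dg le_rfl eg)
    beta_reduce at h
    rw [hc3 _ (by omega), coeff_sub, coeff_C_mul, cg] at h
    have h2 : (θs 0 - θs p.natDegree) * p.leadingCoeff = 0 := by
      rw [leadingCoeff]; linear_combination -h
    rcases mul_eq_zero.mp h2 with h2 | h2
    · exact hsi 0 p.natDegree (by omega) hpd (by omega) (sub_eq_zero.mp h2)
    · rw [leadingCoeff_eq_zero] at h2
      rw [h2] at hlt; simp at hlt
  obtain ⟨g, dg, cg, eg⟩ := deg_act hc 3 p hp3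
  have h := congrArg (fun q => q.coeff 3) (hpoly 3 (by omega) g dg hp3 eg)
  beta_reduce at h
  rw [coeff_sub, coeff_sub, coeff_C_mul, cg, show (3 : ℕ) = 1 + 2 from rfl, coeff_X_pow_mul,
    c1, show (1 + 2 : ℕ) = 2 + 1 from rfl, coeff_X_mul, c2] at h
  simp at h
  have hp0 : p.coeff 3 ≠ 0 := by
    intro e
    rw [e] at h
    exact hsi 1 2 (by omega) (by omega) (by omega) (sub_eq_zero.mp (by linear_combination h))
  have hpx : ∀ x, p.eval x = p.coeff 3 * x ^ 3 + p.coeff 2 * x ^ 2 + p.coeff 1 * x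
      + p.coeff 0 := by
    intro x
    rw [eval_eq_sum_range' (n := 4) (by omega)]
    simp [Finset.sum_range_succ]; ring
  have hq : ∀ i, i + 1 ≤ d → p.coeff 3 * (θ i ^ 2 + θ i * θ (i + 1) + θ (i + 1) ^ 2)
      + p.coeff 2 * (θ i + θ (i + 1)) + p.coeff 1 = θ i * θ (i + 1) := by
    intro i hi
    have h1 := hstep i hi
    rw [hpx, hpx] at h1
    refine mul_right_cancel₀ (sub_ne_zero.mpr (hc.inj i (i + 1) (by omega) hi (by omega))) ?_
    linear_combination h1
  refine ⟨1 / p.coeff 3 - 1, -p.coeff 2 / p.coeff 3, fun j hj => ?_⟩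
  have h1 := hq j (by omega)
  have h2 := hq (j + 1) hj
  have h3 : p.coeff 3 * (θ j + θ (j + 1) + θ (j + 2)) + p.coeff 2 = θ (j + 1) := by
    refine mul_right_cancel₀ (sub_ne_zero.mpr (hc.inj (j + 2) j (by omega) (by omega)
      (by omega))) ?_
    linear_combination h2 - h1
  field_simp
  linear_combination h3

theorem forward_half (hc : Core d θ θs φ t) (ht : Irr t)
    (hsi : ∀ i j, i ≤ d → j ≤ d → i ≠ j → θs i ≠ θs j) :
    ∃ β γ γs ω : K, Rec β γ d θ ∧ Rec β γs d θs ∧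
      (∀ j, j + 1 ≤ d → Om β γ γs θ θs φ j = ω) ∧ (2 ≤ d → CC d θ θs φ) ∧
      (∀ i, 1 ≤ i → i ≤ d → φ i ≠ 0) ∧ (∀ i, 1 ≤ i → i ≤ d → phip d θ θs φ i ≠ 0) := by
  obtain ⟨β, γ, hθ⟩ := exists_beta hc ht hsi
  obtain ⟨ρ, hρ⟩ := rho_const hθ
  set γs := θs 0 - β * θs 1 + θs 2 with hγs
  set ω := Om β γ γs θ θs φ 0 with hω
  set η := dg θ θs φ β γ γs ρ ω 0 with hη
  have hM0 : AW d θ t β γ γs ρ ω η *ᵥ U d θ 0 = 0 := by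
    rw [AW_U hc]
    simp [hc.φ0, ← hγs, ← hω, ← hη]
  have hoff : ∀ i j : Fin (d + 1), i ≠ j → AW d θ t β γ γs ρ ω η i j = 0 := by
    intro i j hij
    have hij' : (i : ℕ) ≠ j := fun e => hij (Fin.ext e)
    rw [AW_apply _ _ _ _ _ _ _ _ hij]
    by_cases h1 : 1 < |((i : ℕ) : ℤ) - ((j : ℕ) : ℤ)|
    · rw [(ht i j).1 h1]; ring
    · rw [lt_abs] at h1
      obtain h | h : (i : ℕ) + 1 = j ∨ (j : ℕ) + 1 = i := by omega
      · have := hρ i (by omega)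
        rw [← h]
        linear_combination t i j * this
      · have := hρ j (by omega)
        rw [← h]
        linear_combination t i j * this
  have hM : AW d θ t β γ γs ρ ω η = 0 := by
    ext i j
    by_cases hij : i = j
    · subst hij
      have := congrFun hM0 i
      rw [mulVec, dotProduct, Finset.sum_eq_single i (fun b _ hb => by
        rw [hoff i b hb.symm, zero_mul]) (by simp)] at this
      simpa [U] using this
    · exact hoff i j hij
  have h4 : ∀ j, j + 1 ≤ d → _ := fun j hj => by
    have := AW_U hc β γ γs ρ ω η j
    rw [hM, zero_mulVec] at this
    exact ind4 hc.inj j hj _ _ _ _ this.symm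
  have hlow : ∀ k l : Fin (d + 1), (l : ℕ) + 1 < k → t k l = 0 := fun k l h =>
    (ht k l).1 (by rw [lt_abs]; omega)
  refine ⟨β, γ, γs, ω, hθ, fun j hj => ?_, fun j hj => sub_eq_zero.mp (h4 j hj).1, fun hd => ?_,
    fun i hi hid => ?_, fun i hi hid => ?_⟩
  · linear_combination (h4 j (by omega)).2 hj
  · exact (corner_iff hc hd (fun k l h _ => hlow k l h)).mp (hlow _ _ (by simp; omega))
  · intro e
    have := upper_adj hc ⟨i - 1, by omega⟩ ⟨i, by omega⟩ (by simp only; omega)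
    simp only at this
    rw [e, zero_mul] at this
    refine mul_ne_zero ((ht _ _).2 ?_) (U_ne hc.inj _ _ le_rfl) this
    rw [abs_eq (by norm_num)]; simp only; omega
  · intro e
    have := lemmaN hc hθ hlow i hi hid ⟨d - i + 1, by omega⟩ ⟨d - i, by omega⟩ rfl rfl
    simp only at this
    unfold phip at e
    rw [e, zero_mul] at this
    refine mul_ne_zero ((ht _ _).2 ?_) (eta_ne hc.inj _ _ (by omega)) this
    rw [abs_eq (by norm_num)]; simp only; omega

theorem semi_aeval {W A D : Matrix (Fin (d + 1)) (Fin (d + 1)) K} (h : W * A = D * W) (q : K[X]) :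
    W * aeval A q = aeval D q * W := by
  induction q using Polynomial.induction_on' with
  | add p q hp hq => rw [map_add, map_add, mul_add, add_mul, hp, hq]
  | monomial n a =>
    have hs : SemiconjBy W A D := h
    rw [aeval_monomial, aeval_monomial, ← Algebra.smul_def, ← Algebra.smul_def, mul_smul_comm,
      smul_mul_assoc, (hs.pow_right n).eq]

theorem aeval_diag (b : Fin (d + 1) → K) (q : K[X]) :
    aeval (diagonal b) q = diagonal (fun k => q.eval (b k)) := by
  induction q using Polynomial.induction_on' with
  | add p q hp hq => rw [map_add, hp, hq, diagonal_add]; simp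
  | monomial n a =>
    rw [aeval_monomial, ← Algebra.smul_def, diagonal_pow, ← diagonal_smul]
    congr 1
    ext k
    simp

theorem transpose_aeval (A : Matrix (Fin (d + 1)) (Fin (d + 1)) K) (q : K[X]) :
    aeval Aᵀ q = (aeval A q)ᵀ := by
  induction q using Polynomial.induction_on' with
  | add p q hp hq => rw [map_add, map_add, hp, hq, transpose_add]
  | monomial n a =>
    rw [aeval_monomial, aeval_monomial, ← Algebra.smul_def, ← Algebra.smul_def, transpose_smul,
      transpose_pow]

theorem prim_eval (a : Fin (d + 1) → K) (ha : Function.Injective a) (i l : Fin (d + 1)) :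
    (∏ j ∈ Finset.univ.erase i, (Polynomial.C (a i - a j)⁻¹ * (Polynomial.X - Polynomial.C (a j)))
      ).eval (a l) = if l = i then 1 else 0 := by
  rw [eval_prod]
  split_ifs with h
  · subst h
    refine Finset.prod_eq_one fun j hj => ?_
    have : a l - a j ≠ 0 := sub_ne_zero.mpr fun e => (Finset.ne_of_mem_erase hj) (ha e).symm
    simp [this]
  · refine Finset.prod_eq_zero (Finset.mem_erase.mpr ⟨h, Finset.mem_univ l⟩) ?_
    simp

theorem link {W W' A B : Matrix (Fin (d + 1)) (Fin (d + 1)) K} (hW : W * W' = 1) (hW' : W' * W = 1)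
    (b : Fin (d + 1) → K) (hA : W * A = diagonal b * W) (σ : Equiv.Perm (Fin (d + 1)))
    (a : Fin (d + 1) → K) (hab : ∀ i, a i = b (σ i)) (ha : Function.Injective a)
    (i j : Fin (d + 1)) :
    primIdem A a i * B * primIdem A a j = 0 ↔ (W * B * W') (σ i) (σ j) = 0 := by
  have key : ∀ i, W * primIdem A a i = diagonal (Pi.single (σ i) 1) * W := by
    intro i
    rw [primIdem, semi_aeval hA, aeval_diag]
    congr 2
    ext k
    obtain ⟨l, rfl⟩ := σ.surjective k
    rw [← hab, prim_eval a ha, Pi.single_apply]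
    simp
  have e : W * (primIdem A a i * B * primIdem A a j) * W' =
      diagonal (Pi.single (σ i) 1) * (W * B * W') * diagonal (Pi.single (σ j) 1) := by
    have : primIdem A a j * W' = W' * diagonal (Pi.single (σ j) 1) := by
      calc primIdem A a j * W' = W' * (W * primIdem A a j) * W' := by
            rw [← mul_assoc W', hW', one_mul]
        _ = _ := by rw [key, mul_assoc, mul_assoc, hW, mul_one]
    calc _ = (W * primIdem A a i) * B * (primIdem A a j * W') := by simp only [mul_assoc]
      _ = _ := by rw [key, this]; simp only [mul_assoc]
  constructor
  · intro h
    rw [h, mul_zero, zero_mul] at e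
    have := congrFun (congrFun e (σ i)) (σ j)
    rw [mul_diagonal, diagonal_mul] at this
    simpa using this.symm
  · intro h
    have z : diagonal (Pi.single (σ i) 1) * (W * B * W') * diagonal (Pi.single (σ j) 1) = 0 := by
      ext k l
      rw [mul_diagonal, diagonal_mul, Pi.single_apply, Pi.single_apply]
      split_ifs with h1 h2
      · rw [h1, h2, h]; simp
      all_goals simp
    rw [z] at e
    calc _ = W' * (W * (primIdem A a i * B * primIdem A a j) * W') * W := by
          simp only [mul_assoc]; rw [hW', mul_one]; simp only [← mul_assoc]; rw [hW', one_mul]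
      _ = 0 := by rw [e]; simp

theorem eig_transfer {A B A' B' P P' : Matrix (Fin (d + 1)) (Fin (d + 1)) K} (hP : P * P' = 1)
    (hP' : P' * P = 1) (hA : A' = P' * Aᵀ * P) (hB : B' = P' * Bᵀ * P) (a : Fin (d + 1) → K)
    (hm : MultFreeWith A a) (h : IsEigenvalueSeq A' B' a) : IsEigenvalueSeq A B a := by
  refine ⟨hm, ?_⟩
  have hPA : P * A' = Aᵀ * P := by rw [hA, mul_assoc P', ← mul_assoc, hP, one_mul]
  have hPB : P * B' = Bᵀ * P := by rw [hB, mul_assoc P', ← mul_assoc, hP, one_mul]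
  have key : ∀ i, P * primIdem A' a i = (primIdem A a i)ᵀ * P := by
    intro i
    rw [primIdem, semi_aeval hPA, transpose_aeval]; rfl
  have e : ∀ i j, P * (primIdem A' a i * B' * primIdem A' a j) =
      (primIdem A a j * B * primIdem A a i)ᵀ * P := by
    intro i j
    rw [← mul_assoc, ← mul_assoc, key, mul_assoc _ P, hPB, ← mul_assoc, mul_assoc _ P, key,
      transpose_mul, transpose_mul]
    simp only [mul_assoc]
  have z : ∀ i j, primIdem A' a i * B' * primIdem A' a j = 0 ↔
      primIdem A a j * B * primIdem A a i = 0 := by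
    intro i j
    constructor
    · intro h
      have h1 := e i j
      rw [h, mul_zero] at h1
      have : (primIdem A a j * B * primIdem A a i)ᵀ = 0 := by
        rw [← mul_one (_)ᵀ, ← hP, ← mul_assoc, ← h1, zero_mul]
      exact transpose_eq_zero.mp this
    · intro h
      have h1 := e i j
      rw [h, transpose_zero, zero_mul] at h1
      rw [← one_mul (primIdem A' a i * B' * primIdem A' a j), ← hP', mul_assoc, h1, mul_zero]
  intro i j
  have := h.2 j i
  rw [z j i, abs_sub_comm, Ne, z j i] at this
  exact this

/-- normalized bidiagonal pair -/
structure Lk (A B : Matrix (Fin (d + 1)) (Fin (d + 1)) K) (θ θs φ : ℕ → K) : Prop where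
  hA : ∀ i j : Fin (d + 1), A i j = if (i : ℕ) = j then θ i else if (i : ℕ) = j + 1 then 1 else 0
  hB : ∀ i j : Fin (d + 1), B i j =
    if (i : ℕ) = j then θs i else if (j : ℕ) = i + 1 then φ j else 0
  φ0 : φ 0 = 0
  φd : φ (d + 1) = 0

variable {A B : Matrix (Fin (d + 1)) (Fin (d + 1)) K}

theorem charpoly_lower (hA : ∀ i j : Fin (d + 1), i < j → A i j = 0) :
    A.charpoly = ∏ i, (X - C (A i i)) := by
  rw [← charpoly_transpose, charpoly_of_isUpperTriangular]
  · simp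
  · intro i j hij
    exact hA _ _ hij

theorem charpoly_upper (hA : ∀ i j : Fin (d + 1), j < i → A i j = 0) :
    A.charpoly = ∏ i, (X - C (A i i)) :=
  charpoly_of_isUpperTriangular _ fun i j hij => hA _ _ hij

def Wm (d : ℕ) (θ : ℕ → K) : Matrix (Fin (d + 1)) (Fin (d + 1)) K := Matrix.of fun k j => U d θ j k

theorem Wm_det (hc : ∀ i j, i ≤ d → j ≤ d → i ≠ j → θ i ≠ θ j) : IsUnit (Wm d θ).det := by
  rw [det_of_isLowerTriangular (Wm d θ) (fun (i j : Fin (d + 1)) hij => U_lt d θ j i hij)]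
  exact (Finset.prod_ne_zero_iff.mpr fun (i : Fin (d + 1)) _ => U_ne hc i i le_rfl).isUnit

theorem Wm_A (h : Lk A B θ θs φ) : Wm d θ * A = TH d θ * Wm d θ := by
  ext k j
  rw [mul_apply]
  have e : ∀ i : Fin (d + 1), Wm d θ k i * A i j =
      (if i = j then θ j * U d θ j k else 0) +
      (if (i : ℕ) = j + 1 then U d θ (j + 1) k else 0) := by
    intro i
    rw [h.hA]
    simp only [Wm, of_apply]
    by_cases h1 : i = j
    · subst h1; simp; ring
    · have : (i : ℕ) ≠ j := fun e => h1 (Fin.ext e)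
      by_cases h2 : (i : ℕ) = j + 1
      · simp [h1, h2]
      · simp [h1, this, h2]
  rw [Finset.sum_congr rfl fun i _ => e i, Finset.sum_add_distrib]
  have e2 : ∑ i : Fin (d + 1), (if (i : ℕ) = j + 1 then U d θ (j + 1) k else 0) =
      U d θ (j + 1) k := by
    by_cases hj : (j : ℕ) + 1 ≤ d
    · rw [Finset.sum_eq_single (⟨j + 1, by omega⟩ : Fin (d + 1))]
      · simp
      · intro b _ hb
        rw [if_neg]
        exact fun e => hb (Fin.ext e)
      · simp
    · rw [U_big d θ _ (by omega)]; simp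
  rw [e2, TH, diagonal_mul]
  simp [Wm, U_succ]; ring

theorem Wm_B (h : Lk A B θ θs φ) (k j : Fin (d + 1)) : (Wm d θ * B) k j =
    θs j * U d θ j k + φ j * U d θ (j - 1) k := by
  rw [mul_apply]
  have e : ∀ i : Fin (d + 1), Wm d θ k i * B i j =
      (if i = j then θs j * U d θ j k else 0) +
      (if (j : ℕ) = i + 1 then φ j * U d θ (j - 1) k else 0) := by
    intro i
    rw [h.hB]
    simp only [Wm, of_apply]
    by_cases h1 : i = j
    · subst h1; simp; ring
    · have : (i : ℕ) ≠ j := fun e => h1 (Fin.ext e)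
      by_cases h2 : (j : ℕ) = i + 1
      · simp [h1, h2]; ring
      · simp [h1, this, h2]
  rw [Finset.sum_congr rfl fun i _ => e i, Finset.sum_add_distrib]
  have e2 : ∑ i : Fin (d + 1), (if (j : ℕ) = i + 1 then φ j * U d θ (j - 1) k else 0) =
      φ j * U d θ (j - 1) k := by
    by_cases hj : 1 ≤ (j : ℕ)
    · rw [Finset.sum_eq_single (⟨j - 1, by omega⟩ : Fin (d + 1))]
      · rw [if_pos (by simp only; omega)]
      · intro b _ hb
        rw [if_neg]
        exact fun e => hb (Fin.ext (by simp only; omega))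
      · simp
    · rw [show (j : ℕ) = 0 by omega, h.φ0]; simp
  rw [e2]
  simp

noncomputable def tm (θ : ℕ → K) (B : Matrix (Fin (d + 1)) (Fin (d + 1)) K) :
    Matrix (Fin (d + 1)) (Fin (d + 1)) K := Wm d θ * B * (Wm d θ)⁻¹

theorem tm_core (h : Lk A B θ θs φ) (hc : ∀ i j, i ≤ d → j ≤ d → i ≠ j → θ i ≠ θ j) :
    Core d θ θs φ (tm θ B) := by
  refine ⟨hc, h.φ0, h.φd, fun j => ?_⟩
  have hu := Wm_det hc
  have e : tm θ B * Wm d θ = Wm d θ * B := by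
    rw [tm, mul_assoc, nonsing_inv_mul _ hu, mul_one]
  by_cases hj : j ≤ d
  · ext k
    have h1 := congrFun (congrFun e k) ⟨j, by omega⟩
    rw [Wm_B h, mul_apply] at h1
    simpa [mulVec, dotProduct, Wm] using h1
  · rw [U_big d θ j (by omega), mulVec_zero, smul_zero, zero_add]
    by_cases h2 : j = d + 1
    · rw [h2, h.φd, zero_smul]
    · rw [U_big d θ _ (by omega), smul_zero]

theorem roots_inj {a b : Fin (d + 1) → K} (ha : Function.Injective a)
    (h : ∏ i, (X - C (a i)) = ∏ i, (X - C (b i))) :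
    ∃ σ : Equiv.Perm (Fin (d + 1)), ∀ i, a i = b (σ i) := by
  have h1 : ∀ i, ∃ j, a i = b j := by
    intro i
    have := congrArg (eval (a i)) h
    rw [eval_prod, eval_prod, Finset.prod_eq_zero (Finset.mem_univ i) (by simp)] at this
    obtain ⟨j, -, hj⟩ := Finset.prod_eq_zero_iff.mp this.symm
    exact ⟨j, by simpa [sub_eq_zero] using hj⟩
  choose σ hσ using h1
  have hi : Function.Injective σ := fun i j e => ha (by rw [hσ, hσ, e])
  exact ⟨Equiv.ofBijective σ (Finite.injective_iff_bijective.mp hi), fun i => hσ i⟩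

theorem isom (f : ℕ → ℤ) (d : ℕ) (h1 : ∀ i, i + 1 ≤ d → |f (i + 1) - f i| = 1)
    (h2 : ∀ i, i + 2 ≤ d → f (i + 2) ≠ f i) :
    ∃ ε : ℤ, (ε = 1 ∨ ε = -1) ∧ ∀ i, i ≤ d → f i = f 0 + ε * i := by
  by_cases hd : d = 0
  · exact ⟨1, Or.inl rfl, fun i hi => by rw [show i = 0 by omega]; simp⟩
  have hs : ∀ i, i + 1 ≤ d → f (i + 1) - f i = f 1 - f 0 := by
    intro i
    induction i with
    | zero => intro _; rfl
    | succ i ih =>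
      intro hi
      have a := ih (by omega)
      have b := h1 i (by omega)
      have c := h1 (i + 1) hi
      have e := h2 i hi
      rw [abs_eq (by norm_num)] at b c
      rw [show i + 1 + 1 = i + 2 from rfl] at *
      omega
  have h0 := h1 0 (by omega)
  rw [abs_eq (by norm_num)] at h0
  refine ⟨f 1 - f 0, h0, fun i => ?_⟩
  induction i with
  | zero => intro _; simp
  | succ i ih =>
    intro hi
    have a := ih (by omega)
    have b := hs i hi
    push_cast
    linear_combination a + b

theorem perm_adj (σ : Equiv.Perm (Fin (d + 1)))
    (h : ∀ i j : Fin (d + 1), |((i : ℕ) : ℤ) - ((j : ℕ) : ℤ)| = 1 →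
      |((σ i : ℕ) : ℤ) - ((σ j : ℕ) : ℤ)| = 1) (i j : Fin (d + 1)) :
    |((σ i : ℕ) : ℤ) - ((σ j : ℕ) : ℤ)| = |((i : ℕ) : ℤ) - ((j : ℕ) : ℤ)| := by
  let f : ℕ → ℤ := fun n => if h : n ≤ d then ((σ ⟨n, by omega⟩ : ℕ) : ℤ) else 0
  have hf : ∀ n (hn : n ≤ d), f n = ((σ ⟨n, by omega⟩ : ℕ) : ℤ) := fun n hn => dif_pos hn
  obtain ⟨ε, hε, he⟩ := isom f d (fun i hi => by
    rw [hf _ hi, hf i (by omega)]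
    exact h _ _ (by simp)) (fun i hi e => by
    rw [hf _ hi, hf i (by omega)] at e
    have := σ.injective (Fin.ext (by exact_mod_cast e))
    simp at this)
  have hi := he i (by omega)
  have hj := he j (by omega)
  rw [hf i (by omega)] at hi
  rw [hf j (by omega)] at hj
  simp only [Fin.eta] at hi hj
  rw [hi, hj, show f 0 + ε * ((i : ℕ) : ℤ) - (f 0 + ε * ((j : ℕ) : ℤ)) =
    ε * (((i : ℕ) : ℤ) - ((j : ℕ) : ℤ)) by ring, abs_mul]
  rcases hε with rfl | rfl <;> simp

theorem Lk.charA (h : Lk A B θ θs φ) : A.charpoly = ∏ i : Fin (d + 1), (X - C (θ i)) := by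
  rw [charpoly_lower]
  · refine Finset.prod_congr rfl fun i _ => ?_
    rw [h.hA]; simp
  · intro i j hij
    have : (i : ℕ) < j := hij
    rw [h.hA, if_neg (by omega), if_neg (by omega)]

theorem Lk.charB (h : Lk A B θ θs φ) : B.charpoly = ∏ i : Fin (d + 1), (X - C (θs i)) := by
  rw [charpoly_upper]
  · refine Finset.prod_congr rfl fun i _ => ?_
    rw [h.hB]; simp
  · intro i j hij
    have : (j : ℕ) < i := hij
    rw [h.hB, if_neg (by omega), if_neg (by omega)]

theorem inj_of {M : Matrix (Fin (d + 1)) (Fin (d + 1)) K} {a : Fin (d + 1) → K}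
    (hm : MultFreeWith M a) (hM : M.charpoly = ∏ i : Fin (d + 1), (X - C (θ i))) :
    (∀ i j, i ≤ d → j ≤ d → i ≠ j → θ i ≠ θ j) ∧
      ∃ σ : Equiv.Perm (Fin (d + 1)), ∀ i, a i = θ (σ i) := by
  obtain ⟨σ, hσ⟩ := roots_inj (b := fun i => θ i) hm.1 (hm.2.symm.trans hM)
  refine ⟨fun i j hi hj hij e => hij ?_, σ, hσ⟩
  have : a (σ.symm ⟨i, by omega⟩) = a (σ.symm ⟨j, by omega⟩) := by
    rw [hσ, hσ]; simpa using e
  simpa using hm.1 this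

theorem eig_forward (h : Lk A B θ θs φ) {a : Fin (d + 1) → K} (he : IsEigenvalueSeq A B a) :
    (∀ i j, i ≤ d → j ≤ d → i ≠ j → θ i ≠ θ j) ∧ Irr (tm θ B) := by
  obtain ⟨hi, σ, hσ⟩ := inj_of he.1 h.charA
  have hc := tm_core h hi
  have hu := Wm_det hi
  have hl := fun i j => link (B := B) (mul_nonsing_inv _ hu) (nonsing_inv_mul _ hu)
    (fun k : Fin (d + 1) => θ k) (Wm_A h) σ a hσ he.1.1 i j
  refine ⟨hi, ?_⟩
  have hp := perm_adj σ (fun i j hij => by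
    have h1 := (he.2 i j).2 hij
    have h2 := (he.2 j i).2 (by rwa [abs_sub_comm])
    rw [Ne, hl] at h1 h2
    have n1 : ¬ ((σ i : ℕ) + 1 < σ j) := fun h => h1 (upper_zero hc _ _ h)
    have n2 : ¬ ((σ j : ℕ) + 1 < σ i) := fun h => h2 (upper_zero hc _ _ h)
    have n3 : (σ i : ℕ) ≠ σ j := fun e => by
      have := σ.injective (Fin.ext e)
      rw [this] at hij; simp at hij
    rw [abs_eq (by norm_num)]; omega)
  intro k l
  obtain ⟨i, rfl⟩ := σ.surjective k
  obtain ⟨j, rfl⟩ := σ.surjective l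
  rw [hp]
  have := he.2 i j
  rw [Ne, hl] at this
  exact this

theorem eig_backward (h : Lk A B θ θs φ) (hi : ∀ i j, i ≤ d → j ≤ d → i ≠ j → θ i ≠ θ j)
    (ht : Irr (tm θ B)) : IsEigenvalueSeq A B (fun i => θ i) := by
  have hu := Wm_det hi
  have hinj : Function.Injective (fun i : Fin (d + 1) => θ i) := by
    intro a b hab
    by_contra hne
    exact hi a b (by omega) (by omega) (fun e => hne (Fin.ext e)) hab
  have hl := fun i j => link (B := B) (mul_nonsing_inv _ hu) (nonsing_inv_mul _ hu)
    (fun k : Fin (d + 1) => θ k) (Wm_A h) 1 (fun i => θ i) (fun i => rfl) hinj i j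
  refine ⟨⟨hinj, h.charA⟩, fun i j => ?_⟩
  rw [Ne, hl]
  exact ht i j

theorem S_prop {β γ γs : K} (hθ : Rec β γ d θ) (hs : Rec β γs d θs) (i : ℕ) (hi : i ≤ d + 1) :
    S d θs i * (θ 0 - θ d) = S d θ i * (θs 0 - θs d) := by
  have hu : ∀ h, (h ≤ d → (θs h - θs (d - h)) * (θ 0 - θ d) = (θ h - θ (d - h)) * (θs 0 - θs d)) ∧
      (h + 1 ≤ d → (θs (h + 1) - θs (d - (h + 1))) * (θ 0 - θ d)
        = (θ (h + 1) - θ (d - (h + 1))) * (θs 0 - θs d)) := by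
    intro h
    induction h with
    | zero =>
      refine ⟨fun _ => by simp; ring, fun hd => ?_⟩
      have := wron β d γ γs θ θs hd hθ hs
      simp only [Nat.zero_add]
      linear_combination this
    | succ h ih =>
      refine ⟨ih.2, fun hd => ?_⟩
      have a := ih.1 (by omega)
      have b := ih.2 (by omega)
      have h1 := hθ h hd
      have h2 := hs h hd
      have h3 := hθ (d - (h + 2)) (by omega)
      have h4 := hs (d - (h + 2)) (by omega)
      rw [show d - (h + 2) + 2 = d - h by omega, show d - (h + 2) + 1 = d - (h + 1) by omega]
        at h3 h4
      rw [show h + 1 + 1 = h + 2 from rfl]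
      linear_combination β * b - a + (θ 0 - θ d) * (h2 - h4) - (θs 0 - θs d) * (h1 - h3)
  induction i with
  | zero => simp
  | succ i ih =>
    rw [S_succ, S_succ]
    linear_combination ih (by omega) + (hu i).1 (by omega)

theorem phip_dual {β γ γs : K} (hθ : Rec β γ d θ) (hs : Rec β γs d θs) (n1 : θ 0 ≠ θ d)
    (n2 : θs 0 ≠ θs d) (i : ℕ) (hi : 1 ≤ i) (hid : i ≤ d) :
    phip d θs θ φ i = phip d θ θs φ (d - i + 1) := by
  unfold phip
  have h := S_prop hθ hs i (by omega)
  rw [show d - (d - i + 1) + 1 = i by omega, show d - i + 1 = d + 1 - i by omega,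
    ← S_symm d θ i (by omega)]
  have m1 := sub_ne_zero.mpr n1
  have m2 := sub_ne_zero.mpr n2
  have : φ 1 * S d θs i / (θs 0 - θs d) = φ 1 * S d θ i / (θ 0 - θ d) := by
    rw [div_eq_div_iff m2 m1]
    linear_combination φ 1 * h
  rw [this]; ring

theorem dual_lk (h : Lk A B θ θs φ) (hφ : ∀ i, 1 ≤ i → i ≤ d → φ i ≠ 0) :
    ∃ P P' : Matrix (Fin (d + 1)) (Fin (d + 1)) K, P * P' = 1 ∧ P' * P = 1 ∧
      Lk (P' * Bᵀ * P) (P' * Aᵀ * P) θs θ φ := by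
  let p : ℕ → K := fun n => ∏ h ∈ Finset.range n, φ (h + 1)
  have hp : ∀ n, n ≤ d → p n ≠ 0 := fun n hn => Finset.prod_ne_zero_iff.mpr fun l hl => by
    rw [Finset.mem_range] at hl
    exact hφ _ (by omega) (by omega)
  have hps : ∀ n, p (n + 1) = p n * φ (n + 1) := fun n => Finset.prod_range_succ _ _
  refine ⟨diagonal (fun k : Fin (d + 1) => p k), diagonal (fun k : Fin (d + 1) => (p k)⁻¹), ?_, ?_,
    ?_, ?_, h.φ0, h.φd⟩
  · rw [diagonal_mul_diagonal, ← diagonal_one]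
    congr 1; ext k
    exact mul_inv_cancel₀ (hp k (by omega))
  · rw [diagonal_mul_diagonal, ← diagonal_one]
    congr 1; ext k
    exact inv_mul_cancel₀ (hp k (by omega))
  · intro i j
    rw [mul_diagonal, diagonal_mul, transpose_apply, h.hB]
    have hi := hp i (by omega)
    have hj := hp j (by omega)
    by_cases h1 : (i : ℕ) = j
    · rw [if_pos h1.symm, if_pos h1, h1]
      field_simp
    · rw [if_neg (Ne.symm h1), if_neg h1]
      by_cases h2 : (i : ℕ) = j + 1
      · rw [if_pos h2, if_pos h2, h2, hps]
        rw [h2, hps] at hi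
        have := right_ne_zero_of_mul hi
        field_simp
      · rw [if_neg h2, if_neg h2]; ring
  · intro i j
    rw [mul_diagonal, diagonal_mul, transpose_apply, h.hA]
    have hi := hp i (by omega)
    have hj := hp j (by omega)
    by_cases h1 : (i : ℕ) = j
    · rw [if_pos h1.symm, if_pos h1, h1]
      field_simp
    · rw [if_neg (Ne.symm h1), if_neg h1]
      by_cases h2 : (j : ℕ) = i + 1
      · rw [if_pos h2, if_pos h2, h2, hps]
        field_simp
      · rw [if_neg h2, if_neg h2]; ring

theorem rec_of {b : K} (h : ∀ i, 2 ≤ i → i + 1 ≤ d → (θ (i - 2) - θ (i + 1)) / (θ (i - 1) - θ i) = b)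
    (hi : ∀ i j, i ≤ d → j ≤ d → i ≠ j → θ i ≠ θ j) :
    Rec (b - 1) (θ 2 - (b - 1) * θ 1 + θ 0) d θ := by
  intro j
  induction j with
  | zero => intro _; rfl
  | succ j ih =>
    intro hj
    have h1 := ih (by omega)
    have h2 := h (j + 2) (by omega) (by omega)
    simp only [Nat.add_sub_cancel, show j + 2 - 1 = j + 1 from rfl,
      show j + 2 + 1 = j + 3 from rfl] at h2
    rw [div_eq_iff (sub_ne_zero.mpr (hi _ _ (by omega) (by omega) (by omega)))] at h2
    rw [show j + 1 + 2 = j + 3 from rfl, show j + 1 + 1 = j + 2 from rfl]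
    linear_combination h1 - h2

theorem div_of {β γ : K} (h : Rec β γ d θ)
    (hi : ∀ i j, i ≤ d → j ≤ d → i ≠ j → θ i ≠ θ j) (i : ℕ) (h2 : 2 ≤ i) (hid : i + 1 ≤ d) :
    (θ (i - 2) - θ (i + 1)) / (θ (i - 1) - θ i) = β + 1 := by
  obtain ⟨j, rfl⟩ : ∃ j, i = j + 2 := ⟨i - 2, by omega⟩
  simp only [Nat.add_sub_cancel, show j + 2 - 1 = j + 1 from rfl, show j + 2 + 1 = j + 3 from rfl]
  rw [div_eq_iff (sub_ne_zero.mpr (hi _ _ (by omega) (by omega) (by omega)))]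
  have a := h j (by omega)
  have b := h (j + 1) (by omega)
  rw [show j + 1 + 2 = j + 3 from rfl, show j + 1 + 1 = j + 2 from rfl] at b
  linear_combination a - b

theorem Lk.congr_phi {φ' : ℕ → K} (h : Lk A B θ θs φ) (e : φ = φ') : Lk A B θ θs φ' := e ▸ h

theorem back_main {φ₀ φp : ℕ → K} (hpa : IsParameterArray K d θ θs φ₀ φp)
    (hl : Lk A B θ θs (fun n => if n = 0 ∨ d < n then 0 else φ₀ n)) : IsLeonardPair A B := by
  obtain ⟨h1, h2, h3, h4, b, h5⟩ := hpa
  have hi : ∀ i j, i ≤ d → j ≤ d → i ≠ j → θ i ≠ θ j := fun i j a b c => (h2 i j a b c).1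
  have hsi : ∀ i j, i ≤ d → j ≤ d → i ≠ j → θs i ≠ θs j := fun i j a b c => (h2 i j a b c).2
  have hθ := rec_of (fun i a b => (h5 i a b).1) hi
  have hs := rec_of (fun i a b => (h5 i a b).2) hsi
  set β := b - 1
  set γ := θ 2 - β * θ 1 + θ 0
  set γs := θs 2 - β * θs 1 + θs 0
  set κ := φp 1 / (θ 0 - θ d) with hκ
  have hφe : (fun n => if n = 0 ∨ d < n then 0 else φ₀ n) = psi d κ θ θs := by
    ext n
    by_cases hn : n = 0 ∨ d < n
    · simp only [psi]; rw [if_pos hn, if_pos hn]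
    · simp only [psi]; rw [if_neg hn, if_neg hn, h3 n (by omega) (by omega), ← Finset.sum_div, hκ]
      unfold S; ring
  replace hl := hl.congr_phi hφe
  have hφv : ∀ i, 1 ≤ i → i ≤ d → psi d κ θ θs i = φ₀ i := fun i a b => by
    rw [← hφe]; simp only; rw [if_neg (by omega)]
  set φ := psi d κ θ θs with hφd
  have hφ : ∀ i, 1 ≤ i → i ≤ d → φ i ≠ 0 := fun i a b => by
    rw [hφv i a b]; exact (h1 i a b).1
  have hφp : ∀ i, 1 ≤ i → i ≤ d → phip d θ θs φ i = φp i := fun i a b => by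
    rw [h4 i a b, phip, hφv 1 le_rfl (by omega), ← Finset.sum_div]
    unfold S; ring
  have hO : ∀ j, j + 1 ≤ d → Om β γ γs θ θs φ j = Om β γ γs θ θs φ 0 := by
    intro j
    induction j with
    | zero => intro _; rfl
    | succ j ih =>
      intro hj
      rw [← ih (by omega)]
      exact psi_Om hθ hs j hj
  have hO' : ∀ j, j + 1 ≤ d → Om β γs γ θs θ φ j = Om β γ γs θ θs φ 0 := by
    intro j hj
    rw [← hO j hj]; unfold Om; ring
  have hC' : 2 ≤ d → CC d θs θ φ := fun hd => psi_CC' (by omega) κ θ θs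
  have hC : 2 ≤ d → CC d θ θs φ := fun hd => CC_symm (by omega) hθ hs (hC' hd)
  constructor
  · refine ⟨_, eig_backward hl hi ?_⟩
    exact backward_half (tm_core hl hi) hθ hs hO hC hφ fun i a b => by
      rw [hφp i a b]; exact (h1 i a b).2
  · obtain ⟨P, P', hP, hP', hl'⟩ := dual_lk hl hφ
    have he := eig_backward hl' hsi (backward_half (tm_core hl' hsi) hs hθ hO' hC' hφ
      fun i a b => by
        rw [phip_dual hθ hs (hi 0 d (by omega) le_rfl (by omega))
          (hsi 0 d (by omega) le_rfl (by omega)) i a b, hφp _ (by omega) (by omega)]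
        exact (h1 _ (by omega) (by omega)).2)
    exact ⟨_, eig_transfer hP hP' rfl rfl _ ⟨he.1.1, hl.charB⟩ he⟩

theorem forw_main (hl : Lk A B θ θs φ) (hL : IsLeonardPair A B) :
    IsParameterArray K d θ θs φ (phip d θ θs φ) := by
  obtain ⟨⟨a, ha⟩, ⟨as, has⟩⟩ := hL
  obtain ⟨hi, ht⟩ := eig_forward hl ha
  obtain ⟨hsi, -⟩ := inj_of has.1 hl.charB
  obtain ⟨β, γ, γs, ω, hθ, hs, hO, hC, hφ, hφp⟩ := forward_half (tm_core hl hi) ht hsi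
  refine ⟨fun i a b => ⟨hφ i a b, hφp i a b⟩, fun i j a b c => ⟨hi i j a b c, hsi i j a b c⟩,
    fun i h1 hid => ?_, fun i h1 hid => ?_, β + 1, fun i a b => ⟨div_of hθ hi i a b,
      div_of hs hsi i a b⟩⟩
  · have n0d := hi 0 d (by omega) le_rfl (by omega)
    have m := sub_ne_zero.mpr n0d
    have := phi_eq_psi (by omega) hθ hs n0d
      (fun h => hi 1 d (by omega) le_rfl (by omega)) hl.φ0 ω hO hC
      (φ 1 / (θ 0 - θ d) - (θs 1 - θs 0)) (by field_simp) i hid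
    rw [this, psi, if_neg (by omega), ← Finset.sum_div, phip, S_one, show d - 1 + 1 = d by omega]
    unfold S
    field_simp
    ring
  · rw [phip, ← Finset.sum_div]; unfold S; ring

theorem mkLk (hLB : LowerBidiagonal A) (hUB : UpperBidiagonal B)
    (hsub : ∀ i j : Fin (d + 1), (i : ℕ) = j + 1 → A i j = 1)
    (e1 : ∀ i : Fin (d + 1), A i i = θ i) (e2 : ∀ i : Fin (d + 1), B i i = θs i)
    (e3 : ∀ i j : Fin (d + 1), (j : ℕ) = i + 1 → B i j = φ j)
    (φ0 : φ 0 = 0) (φd : φ (d + 1) = 0) : Lk A B θ θs φ := by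
  refine ⟨fun i j => ?_, fun i j => ?_, φ0, φd⟩
  · split_ifs with h1 h2
    · rw [← e1]; congr 1; exact Fin.ext h1.symm
    · exact hsub i j h2
    · exact hLB i j h1 h2
  · split_ifs with h1 h2
    · rw [← e2]; congr 1; exact Fin.ext h1.symm
    · exact e3 i j h2
    · exact hUB i j h1 h2

end LP
/-- recognition of a Leonard pair in LB-UB canonical form. -/
theorem leonard_lbub_canonical_iff {d : ℕ}
    (A Astar : Matrix (Fin (d + 1)) (Fin (d + 1)) K)
    (hLB : LowerBidiagonal A) (hUB : UpperBidiagonal Astar)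
    (hsub : ∀ i : ℕ, ∀ _ : 1 ≤ i, ∀ _ : i ≤ d, A ⟨i, by omega⟩ ⟨i - 1, by omega⟩ = 1) :
    IsLeonardPair A Astar ↔
      ∃ θ θs φ φp : ℕ → K, IsParameterArray K d θ θs φ φp ∧
        (∀ i : Fin (d + 1), A i i = θ (i : ℕ) ∧ Astar i i = θs (i : ℕ)) ∧
        (∀ i : ℕ, ∀ _ : 1 ≤ i, ∀ _ : i ≤ d,
          Astar ⟨i - 1, by omega⟩ ⟨i, by omega⟩ = φ i) := by
  have hsub' : ∀ i j : Fin (d + 1), (i : ℕ) = j + 1 → A i j = 1 := fun i j h => by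
    rw [← hsub i (by omega) (by omega)]; congr 1; exact Fin.ext (by simp only; omega)
  constructor
  · intro hL
    let θ : ℕ → K := fun n => if h : n ≤ d then A ⟨n, by omega⟩ ⟨n, by omega⟩ else 0
    let θs : ℕ → K := fun n => if h : n ≤ d then Astar ⟨n, by omega⟩ ⟨n, by omega⟩ else 0
    let φ : ℕ → K := fun n => if h : 1 ≤ n ∧ n ≤ d then
      Astar ⟨n - 1, by omega⟩ ⟨n, by omega⟩ else 0
    have e1 : ∀ i : Fin (d + 1), A i i = θ i := fun i => by
      simp only [θ]; rw [dif_pos (by omega)]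
    have e2 : ∀ i : Fin (d + 1), Astar i i = θs i := fun i => by
      simp only [θs]; rw [dif_pos (by omega)]
    have e3 : ∀ i : ℕ, ∀ _ : 1 ≤ i, ∀ _ : i ≤ d,
        Astar ⟨i - 1, by omega⟩ ⟨i, by omega⟩ = φ i := fun i h1 h2 => by
      simp only [φ]; rw [dif_pos ⟨h1, h2⟩]
    refine ⟨θ, θs, φ, LP.phip d θ θs φ, LP.forw_main (LP.mkLk hLB hUB hsub' e1 e2 (fun i j h => ?_) ?_ ?_) hL,
      fun i => ⟨e1 i, e2 i⟩, e3⟩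
    · rw [← e3 j (by omega) (by omega)]; congr 1; exact Fin.ext (by simp only; omega)
    · simp [φ]
    · simp [φ]
  · rintro ⟨θ, θs, φ, φp, hpa, he, hf⟩
    refine LP.back_main hpa (LP.mkLk hLB hUB hsub' (fun i => (he i).1) (fun i => (he i).2)
      (fun i j h => ?_) ?_ ?_)
    · rw [if_neg (by omega), ← hf j (by omega) (by omega)]
      congr 1; exact Fin.ext (by simp only; omega)
    · simp
    · simp
end
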